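/- If R is a left and right coherent ring, then l.Gwdim(R) = r.Gwdim(R). -/

import Mathlib

/-!
Background definitions for D. Bennis, "Weak Gorenstein global dimensions".

Conventions.  All rings are associative with identity.  A *left* `R`-module is a type with
`[AddCommGroup M] [Module R M]`; a *right* `R`-module is a left module over the opposite ring,
i.e. `[Module Rᵐᵒᵖ M]`.  All "right-handed" notions below are obtained by applying the
corresponding "left-handed" notion to the opposite ring `Rᵐᵒᵖ`.
-/

open MulOpposite

universe u

section Tensor

variable (S : Type u) [Ring S]

/-- The subgroup of relations defining the tensor product `A ⊗_S M` of a right `S`-module `A`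
and a left `S`-module `M` over a (possibly noncommutative) ring `S`. -/
def tensorRels (A : Type u) [AddCommGroup A] [Module Sᵐᵒᵖ A]
    (M : Type u) [AddCommGroup M] [Module S M] :
    AddSubgroup (FreeAbelianGroup (A × M)) :=
  AddSubgroup.closure
    { x | (∃ a₁ a₂ m, x = FreeAbelianGroup.of (a₁ + a₂, m) - FreeAbelianGroup.of (a₁, m) -
            FreeAbelianGroup.of (a₂, m)) ∨
          (∃ a m₁ m₂, x = FreeAbelianGroup.of (a, m₁ + m₂) - FreeAbelianGroup.of (a, m₁) -
            FreeAbelianGroup.of (a, m₂)) ∨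
          (∃ (a : A) (r : S) (m : M), x = FreeAbelianGroup.of (op r • a, m) - FreeAbelianGroup.of (a, r • m)) }

/-- The tensor product `A ⊗_S M` (an abelian group) of a right `S`-module `A` and a left
`S`-module `M` over a (possibly noncommutative) ring `S`. -/
def NTensor (A : Type u) [AddCommGroup A] [Module Sᵐᵒᵖ A]
    (M : Type u) [AddCommGroup M] [Module S M] : Type u :=
  FreeAbelianGroup (A × M) ⧸ tensorRels S A M

instance (A : Type u) [AddCommGroup A] [Module Sᵐᵒᵖ A]
    (M : Type u) [AddCommGroup M] [Module S M] : AddCommGroup (NTensor S A M) :=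
  QuotientAddGroup.Quotient.addCommGroup _

namespace NTensor

variable {S}
variable {A A' : Type u} [AddCommGroup A] [Module Sᵐᵒᵖ A] [AddCommGroup A'] [Module Sᵐᵒᵖ A']
variable {M M' : Type u} [AddCommGroup M] [Module S M] [AddCommGroup M'] [Module S M']

/-- Functoriality of `A ⊗_S −` : the map `A ⊗_S M → A ⊗_S M'` induced by a linear map
`g : M → M'` of left `S`-modules. -/
def rmap (A : Type u) [AddCommGroup A] [Module Sᵐᵒᵖ A] (g : M →ₗ[S] M') :
    NTensor S A M →+ NTensor S A M' :=
  QuotientAddGroup.map (tensorRels S A M) (tensorRels S A M') (FreeAbelianGroup.map (Prod.map id g)) (by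
    simp only [tensorRels]
    refine (AddSubgroup.closure_le _).2 ?_
    rintro x (⟨a₁, a₂, m, rfl⟩ | ⟨a, m₁, m₂, rfl⟩ | ⟨a, r, m, rfl⟩) <;>
      refine SetLike.mem_coe.2 (AddSubgroup.mem_comap.2 (AddSubgroup.subset_closure ?_)) <;>
      simp only [map_sub, map_add, map_smul, FreeAbelianGroup.map_of_apply, Prod.map_apply,
        id_eq, Set.mem_setOf_eq]
    · exact Or.inl ⟨a₁, a₂, g m, rfl⟩
    · exact Or.inr (Or.inl ⟨a, g m₁, g m₂, rfl⟩)
    · exact Or.inr (Or.inr ⟨a, r, g m, rfl⟩))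

/-- Functoriality of `− ⊗_S M` : the map `A ⊗_S M → A' ⊗_S M` induced by a linear map
`f : A → A'` of right `S`-modules. -/
def lmap (M : Type u) [AddCommGroup M] [Module S M] (f : A →ₗ[Sᵐᵒᵖ] A') :
    NTensor S A M →+ NTensor S A' M :=
  QuotientAddGroup.map (tensorRels S A M) (tensorRels S A' M) (FreeAbelianGroup.map (Prod.map f id)) (by
    simp only [tensorRels]
    refine (AddSubgroup.closure_le _).2 ?_
    rintro x (⟨a₁, a₂, m, rfl⟩ | ⟨a, m₁, m₂, rfl⟩ | ⟨a, r, m, rfl⟩) <;>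
      refine SetLike.mem_coe.2 (AddSubgroup.mem_comap.2 (AddSubgroup.subset_closure ?_)) <;>
      simp only [map_sub, map_add, map_smul, FreeAbelianGroup.map_of_apply, Prod.map_apply,
        id_eq, Set.mem_setOf_eq]
    · exact Or.inl ⟨f a₁, f a₂, m, rfl⟩
    · exact Or.inr (Or.inl ⟨f a, m₁, m₂, rfl⟩)
    · exact Or.inr (Or.inr ⟨f a, r, m, rfl⟩))

end NTensor

end Tensor

section Dims

variable (S : Type u) [Ring S]

/-- A left `S`-module `M` is *flat* if tensoring with it preserves injectivity of maps of
right `S`-modules. -/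
def IsFlatMod (M : ModuleCat.{u} S) : Prop :=
  ∀ (A B : Type u) [AddCommGroup A] [Module Sᵐᵒᵖ A] [AddCommGroup B] [Module Sᵐᵒᵖ B]
    (f : A →ₗ[Sᵐᵒᵖ] B), Function.Injective f →
      Function.Injective (NTensor.lmap (↥M) f)

/-- A left `S`-module `M` is *Gorenstein flat* if there is an exact sequence
`⋯ → F (-1) → F 0 → F 1 → ⋯` of flat left `S`-modules with `M ≅ Im (F 0 → F 1)` which stays
exact after applying `I ⊗_S −` for every injective right `S`-module `I`
(a *complete flat resolution*). -/
def IsGorensteinFlat (M : ModuleCat.{u} S) : Prop :=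
  ∃ (F : ℤ → ModuleCat.{u} S) (d : ∀ n : ℤ, ↥(F n) →ₗ[S] ↥(F (n + 1))),
    (∀ n, IsFlatMod S (F n)) ∧
    (∀ n, Function.Exact (d n) (d (n + 1))) ∧
    Nonempty (↥M ≃ₗ[S] ↥(LinearMap.range (d 0))) ∧
    (∀ (I : Type u) [AddCommGroup I] [Module Sᵐᵒᵖ I], Module.Injective Sᵐᵒᵖ I →
      ∀ n, Function.Exact (NTensor.rmap I (d n)) (NTensor.rmap I (d (n + 1))))

/-- `gflatDimLE S n M` means `Gfd_S(M) ≤ n`: there is an exact sequence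
`0 → G_n → ⋯ → G_0 → M → 0` of left `S`-modules with all `G_i` Gorenstein flat. -/
def gflatDimLE : ℕ → ModuleCat.{u} S → Prop
  | 0, M => IsGorensteinFlat S M
  | n + 1, M => ∃ (K G : ModuleCat.{u} S) (ι : ↥K →ₗ[S] ↥G) (π : ↥G →ₗ[S] ↥M),
      Function.Injective ι ∧ Function.Surjective π ∧ Function.Exact ι π ∧
      IsGorensteinFlat S G ∧ gflatDimLE n K

/-- `flatDimLE S n M` means `fd_S(M) ≤ n`: there is an exact sequence
`0 → F_n → ⋯ → F_0 → M → 0` of left `S`-modules with all `F_i` flat. -/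
def flatDimLE : ℕ → ModuleCat.{u} S → Prop
  | 0, M => IsFlatMod S M
  | n + 1, M => ∃ (K F : ModuleCat.{u} S) (ι : ↥K →ₗ[S] ↥F) (π : ↥F →ₗ[S] ↥M),
      Function.Injective ι ∧ Function.Surjective π ∧ Function.Exact ι π ∧
      IsFlatMod S F ∧ flatDimLE n K

/-- `injDimLE S n M` means `id_S(M) ≤ n`: there is an exact sequence
`0 → M → I^0 → ⋯ → I^n → 0` of left `S`-modules with all `I^i` injective. -/
def injDimLE : ℕ → ModuleCat.{u} S → Prop
  | 0, M => Module.Injective S ↥M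
  | n + 1, M => ∃ (I C : ModuleCat.{u} S) (ι : ↥M →ₗ[S] ↥I) (π : ↥I →ₗ[S] ↥C),
      Function.Injective ι ∧ Function.Surjective π ∧ Function.Exact ι π ∧
      Module.Injective S ↥I ∧ injDimLE n C

/-- The Gorenstein flat dimension `Gfd_S(M) ∈ ℕ∞` of a left `S`-module `M`. -/
noncomputable def gflatDim (M : ModuleCat.{u} S) : ℕ∞ :=
  sInf {d : ℕ∞ | ∃ n : ℕ, d = n ∧ gflatDimLE S n M}

/-- The flat dimension `fd_S(M) ∈ ℕ∞` of a left `S`-module `M`. -/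
noncomputable def flatDim (M : ModuleCat.{u} S) : ℕ∞ :=
  sInf {d : ℕ∞ | ∃ n : ℕ, d = n ∧ flatDimLE S n M}

/-- The injective dimension `id_S(M) ∈ ℕ∞` of a left `S`-module `M`. -/
noncomputable def injDim (M : ModuleCat.{u} S) : ℕ∞ :=
  sInf {d : ℕ∞ | ∃ n : ℕ, d = n ∧ injDimLE S n M}

/-- The left weak Gorenstein global dimension
`l.Gwdim(S) = sup { Gfd_S(M) | M a left S-module }`.  The right weak Gorenstein global
dimension of `S` is `gorensteinWeakGlobalDim Sᵐᵒᵖ`. -/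
noncomputable def gorensteinWeakGlobalDim : ℕ∞ :=
  ⨆ M : ModuleCat.{u} S, gflatDim S M

/-- The left weak global dimension `sup { fd_S(M) | M a left S-module }`.  (By a classical
theorem it agrees with `weakGlobalDim Sᵐᵒᵖ`, and the common value is `wdim S`.) -/
noncomputable def weakGlobalDim : ℕ∞ :=
  ⨆ M : ModuleCat.{u} S, flatDim S M

/-- The left finitistic flat dimension
`l.FFD(S) = sup { fd_S(M) | M a left S-module with fd_S(M) < ∞ }`. -/
noncomputable def finitisticFlatDim : ℕ∞ :=
  sSup {d : ℕ∞ | d ≠ ⊤ ∧ ∃ M : ModuleCat.{u} S, flatDim S M = d}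

/-- The left finitistic Gorenstein flat dimension
`l.FGFD(S) = sup { Gfd_S(M) | M a left S-module with Gfd_S(M) < ∞ }`. -/
noncomputable def finitisticGFlatDim : ℕ∞ :=
  sSup {d : ℕ∞ | d ≠ ⊤ ∧ ∃ M : ModuleCat.{u} S, gflatDim S M = d}

/-- A ring `S` is *left GF-closed* if the class of Gorenstein flat left `S`-modules is closed
under extensions.  `S` is right GF-closed iff `Sᵐᵒᵖ` is left GF-closed, and GF-closed if both. -/
def IsGFClosed : Prop :=
  ∀ (A B C : ModuleCat.{u} S) (f : ↥A →ₗ[S] ↥B) (g : ↥B →ₗ[S] ↥C),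
    Function.Injective f → Function.Surjective g → Function.Exact f g →
      IsGorensteinFlat S A → IsGorensteinFlat S C → IsGorensteinFlat S B

/-- A ring `S` is *left coherent* if every finitely generated left ideal of `S` is finitely
presented (as a left `S`-module).  `S` is right coherent iff `Sᵐᵒᵖ` is left coherent. -/
def IsLeftCoherent : Prop :=
  ∀ I : Submodule S S, I.FG → Module.FinitePresentation S ↥I

/-- A ring `S` is *left IF* if every injective left `S`-module is flat.  `S` is right IF iff
`Sᵐᵒᵖ` is left IF, and IF if both. -/
def IsLeftIF : Prop :=
  ∀ E : ModuleCat.{u} S, Module.Injective S ↥E → IsFlatMod S E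

/-- A ring `S` is *left `n`-IF* if `fd_S(E) ≤ n` for every injective left `S`-module `E`.
`S` is right `n`-IF iff `Sᵐᵒᵖ` is left `n`-IF, and `n`-IF if both. -/
def IsLeftNIF (n : ℕ) : Prop :=
  ∀ E : ModuleCat.{u} S, Module.Injective S ↥E → flatDim S E ≤ (n : ℕ∞)

/-- `Ext¹_S(T, K) = 0`, expressed by its standard characterization: every extension of `T`
by `K` (i.e. every short exact sequence `0 → K → X → T → 0`) splits. -/
def Ext1Zero (T K : ModuleCat.{u} S) : Prop :=
  ∀ (X : ModuleCat.{u} S) (ι : ↥K →ₗ[S] ↥X) (π : ↥X →ₗ[S] ↥T),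
    Function.Injective ι → Function.Surjective π → Function.Exact ι π →
      ∃ ρ : ↥X →ₗ[S] ↥K, ρ.comp ι = LinearMap.id

/-- A left `S`-module `K` is *cotorsion* if `Ext¹_S(F, K) = 0` for every flat left
`S`-module `F`. -/
def IsCotorsion (K : ModuleCat.{u} S) : Prop :=
  ∀ F : ModuleCat.{u} S, IsFlatMod S F → Ext1Zero S F K

/-- `Tor₁^S(A, T) = 0` for a right `S`-module `A` and a left `S`-module `T`, expressed by its
standard characterization: for every short exact sequence `0 → K → F → T → 0` of left
`S`-modules with `F` flat, the induced map `A ⊗_S K → A ⊗_S F` is injective. -/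
def Tor1Zero (A : Type u) [AddCommGroup A] [Module Sᵐᵒᵖ A] (T : ModuleCat.{u} S) : Prop :=
  ∀ (K F : ModuleCat.{u} S) (ι : ↥K →ₗ[S] ↥F) (π : ↥F →ₗ[S] ↥T),
    IsFlatMod S F → Function.Injective ι → Function.Surjective π → Function.Exact ι π →
      Function.Injective (NTensor.rmap A ι)

/-- A left `S`-module is *finitely presented* if it admits a presentation with finitely many
generators and relations. -/
abbrev IsFinitelyPresented (M : ModuleCat.{u} S) : Prop :=
  Module.FinitePresentation S ↥M

end Dims

open CategoryTheory Abelian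

/-- An anti-isomorphism between the rings `R` and `S`, so that left `S`-modules are the same as
right `R`-modules and conversely. -/
class OppRing (R S : Type u) [Ring R] [Ring S] where
  /-- the identification of `S` with the opposite ring of `R` -/
  toOp : S ≃+* Rᵐᵒᵖ
  /-- the identification of `R` with the opposite ring of `S` -/
  fromOp : R ≃+* Sᵐᵒᵖ
  fromOp_toOp : ∀ s, fromOp (unop (toOp s)) = op s
  toOp_fromOp : ∀ r, toOp (unop (fromOp r)) = op r

instance (R : Type u) [Ring R] : OppRing R Rᵐᵒᵖ where
  toOp := RingEquiv.refl _
  fromOp := RingEquiv.opOp R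
  fromOp_toOp _ := rfl
  toOp_fromOp _ := rfl

instance (R S : Type u) [Ring R] [Ring S] [h : OppRing R S] : OppRing S R where
  toOp := h.fromOp
  fromOp := h.toOp
  fromOp_toOp := h.toOp_fromOp
  toOp_fromOp := h.fromOp_toOp

/-- The character dual `Hom(M, ℚ/ℤ)` of an `R`-module `M`, regarded as an `S`-module. -/
def CharDual (_R _S : Type u) (M : Type u) [AddCommGroup M] : Type u :=
  M →+ AddCircle (1 : ℚ)

namespace CharDual

section Basic

variable {R S : Type u} {M : Type u} [AddCommGroup M]

instance : AddCommGroup (CharDual R S M) :=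
  inferInstanceAs (AddCommGroup (M →+ AddCircle (1 : ℚ)))

instance : FunLike (CharDual R S M) M (AddCircle (1 : ℚ)) :=
  inferInstanceAs (FunLike (M →+ AddCircle (1 : ℚ)) M (AddCircle (1 : ℚ)))

instance : AddMonoidHomClass (CharDual R S M) M (AddCircle (1 : ℚ)) :=
  inferInstanceAs (AddMonoidHomClass (M →+ AddCircle (1 : ℚ)) M (AddCircle (1 : ℚ)))

@[ext] theorem ext {f g : CharDual R S M} (h : ∀ m, f m = g m) : f = g :=
  DFunLike.ext f g h

@[simp] theorem add_apply (f g : CharDual R S M) (m : M) : (f + g) m = f m + g m := rfl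

@[simp] theorem zero_apply (m : M) : (0 : CharDual R S M) m = 0 := rfl

theorem sum_apply {ι : Type*} (s : Finset ι) (f : ι → CharDual R S M) (m : M) :
    (∑ i ∈ s, f i) m = ∑ i ∈ s, f i m :=
  AddMonoidHom.finsetSum_apply (M := M) (N := AddCircle (1 : ℚ)) f s m

variable [Ring R] [Ring S] [OppRing R S] [Module R M]

instance : Module S (CharDual R S M) where
  smul s f := (f : M →+ AddCircle (1 : ℚ)).comp
    (DistribSMul.toAddMonoidHom M (unop (OppRing.toOp (R := R) s)))
  one_smul f := ext fun m => by
    change f (unop (OppRing.toOp (R := R) (1 : S)) • m) = f m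
    simp
  mul_smul a b f := ext fun m => by
    change f (unop (OppRing.toOp (R := R) (a * b)) • m) =
      f (unop (OppRing.toOp (R := R) b) • unop (OppRing.toOp (R := R) a) • m)
    simp [mul_smul]
  smul_zero _ := rfl
  smul_add _ _ _ := rfl
  add_smul a b f := ext fun m => by
    change f (unop (OppRing.toOp (R := R) (a + b)) • m) =
      f (unop (OppRing.toOp (R := R) a) • m) + f (unop (OppRing.toOp (R := R) b) • m)
    simp [add_smul]
  zero_smul f := ext fun m => by
    change f (unop (OppRing.toOp (R := R) (0 : S)) • m) = 0
    simp

theorem smul_apply (s : S) (f : CharDual R S M) (m : M) :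
    (s • f) m = f (unop (OppRing.toOp (R := R) s) • m) := rfl

end Basic

end CharDual

/-- A character of `B` killed by `f` factors through `g` when `f`, `g` is exact at `B`. -/
theorem exists_character_comp_eq {A B C : Type*} [AddCommGroup A] [AddCommGroup B]
    [AddCommGroup C] {f : A →+ B} {g : B →+ C} (h : Function.Exact f g)
    (φ : B →+ AddCircle (1 : ℚ)) (hφ : ∀ a, φ (f a) = 0) :
    ∃ ψ : C →+ AddCircle (1 : ℚ), ∀ b, ψ (g b) = φ b := by
  obtain ⟨ψ, hψ⟩ := (Module.Baer.of_divisible (AddCircle (1 : ℚ))).extension_property_addMonoidHom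
    (QuotientAddGroup.kerLift g) (QuotientAddGroup.kerLift_injective g)
    (QuotientAddGroup.lift g.ker φ fun b hb => by
      obtain ⟨a, rfl⟩ := (h b).1 hb
      exact hφ a)
  exact ⟨ψ, fun b => DFunLike.congr_fun hψ (b : B ⧸ g.ker)⟩

/-- A character of `A` extends along an injection `A → B`. -/
theorem exists_character_extension {A B : Type*} [AddCommGroup A] [AddCommGroup B]
    {f : A →+ B} (h : Function.Injective f) (φ : A →+ AddCircle (1 : ℚ)) :
    ∃ ψ : B →+ AddCircle (1 : ℚ), ∀ a, ψ (f a) = φ a := by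
  obtain ⟨ψ, hψ⟩ := (Module.Baer.of_divisible (AddCircle (1 : ℚ))).extension_property_addMonoidHom
    f h φ
  exact ⟨ψ, fun a => DFunLike.congr_fun hψ a⟩

/-- Characters separate points. -/
theorem eq_zero_of_forall_character {A : Type*} [AddCommGroup A] {a : A}
    (h : ∀ φ : A →+ AddCircle (1 : ℚ), φ a = 0) : a = 0 :=
  CharacterModule.eq_zero_of_character_apply h

/-- A short exact sequence `0 → A → B → C → 0` of modules. -/
structure IsSES {R : Type u} [Ring R] {A B C : Type u} [AddCommGroup A] [AddCommGroup B]
    [AddCommGroup C] [Module R A] [Module R B] [Module R C]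
    (f : A →ₗ[R] B) (g : B →ₗ[R] C) : Prop where
  inj : Function.Injective f
  surj : Function.Surjective g
  exact : Function.Exact f g

namespace CharDual

section Functor

variable {R S : Type u} [Ring R] [Ring S] [OppRing R S]
variable {M N L : Type u} [AddCommGroup M] [AddCommGroup N] [AddCommGroup L] [Module R M]
  [Module R N] [Module R L]
variable {A B : Type u} [AddCommGroup A] [AddCommGroup B] [Module S A] [Module S B]

variable (S) in
/-- Contravariant functoriality of the character dual. -/
def map (f : M →ₗ[R] N) : CharDual R S N →ₗ[S] CharDual R S M where
  toFun φ := (φ : N →+ AddCircle (1 : ℚ)).comp f.toAddMonoidHom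
  map_add' _ _ := rfl
  map_smul' s φ := ext fun m => by
    change φ (unop (OppRing.toOp (R := R) s) • f m) = φ (f (unop (OppRing.toOp (R := R) s) • m))
    rw [LinearMap.map_smul]

@[simp] theorem map_apply (f : M →ₗ[R] N) (φ : CharDual R S N) (m : M) :
    map S f φ m = φ (f m) := rfl

theorem map_surjective {f : M →ₗ[R] N} (hf : Function.Injective f) :
    Function.Surjective (map S f) := fun φ => by
  obtain ⟨ψ, hψ⟩ := exists_character_extension (f := f.toAddMonoidHom) hf φ
  exact ⟨ψ, ext hψ⟩

theorem map_injective {f : M →ₗ[R] N} (hf : Function.Surjective f) :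
    Function.Injective (map S f) := fun φ ψ h => ext fun n => by
  obtain ⟨m, rfl⟩ := hf n
  exact DFunLike.congr_fun h m

theorem map_exact {f : M →ₗ[R] N} {g : N →ₗ[R] L} (h : Function.Exact f g) :
    Function.Exact (map S g) (map S f) := fun φ => by
  refine ⟨fun hφ => ?_, ?_⟩
  · obtain ⟨ψ, hψ⟩ := exists_character_comp_eq (f := f.toAddMonoidHom) (g := g.toAddMonoidHom)
      h φ fun a => DFunLike.congr_fun hφ a
    exact ⟨ψ, ext hψ⟩
  · rintro ⟨ψ, rfl⟩
    ext m
    simp [h.apply_apply_eq_zero]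

theorem map_isSES {f : M →ₗ[R] N} {g : N →ₗ[R] L} (h : IsSES f g) :
    IsSES (map S g) (map S f) :=
  ⟨map_injective h.surj, map_surjective h.inj, map_exact h.exact⟩

/-- The adjunction `Hom_R(M, A⁺) → Hom_S(A, M⁺)`. -/
def swap (f : M →ₗ[R] CharDual S R A) : A →ₗ[S] CharDual R S M where
  toFun a := AddMonoidHom.flip
    (show M →+ A →+ AddCircle (1 : ℚ) from f.toAddMonoidHom) a
  map_add' a b := ext fun m => map_add (f m) a b
  map_smul' s a := ext fun m => by
    change f m (s • a) = f (unop (OppRing.toOp (R := R) s) • m) a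
    rw [LinearMap.map_smul]
    change f m (s • a) = f m (unop (OppRing.fromOp (S := S) (unop (OppRing.toOp (R := R) s))) • a)
    rw [OppRing.fromOp_toOp, unop_op]

@[simp] theorem swap_apply (f : M →ₗ[R] CharDual S R A) (a : A) (m : M) :
    swap f a m = f m a := rfl

variable (R S M) in
/-- The evaluation map into the double dual. -/
def eval : M →ₗ[R] CharDual S R (CharDual R S M) :=
  swap (R := S) (S := R) LinearMap.id

theorem eval_injective : Function.Injective (eval R S M) := by
  rw [injective_iff_map_eq_zero]
  intro m hm
  exact eq_zero_of_forall_character fun φ => DFunLike.congr_fun hm φ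

end Functor

end CharDual

namespace IsSES

section Diagrams

variable {R : Type u} [Ring R]
variable {A B C N : Type u} [AddCommGroup A] [AddCommGroup B] [AddCommGroup C] [AddCommGroup N]
  [Module R A] [Module R B] [Module R C] [Module R N]

theorem exists_desc {f : A →ₗ[R] B} {g : B →ₗ[R] C} (h : IsSES f g) (k : B →ₗ[R] N)
    (hk : ∀ a, k (f a) = 0) : ∃ k' : C →ₗ[R] N, ∀ b, k' (g b) = k b := by
  have hle : LinearMap.ker g ≤ LinearMap.ker k := fun b hb => by
    obtain ⟨a, rfl⟩ := (h.exact b).1 hb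
    exact hk a
  refine ⟨(Submodule.liftQ _ k hle).comp (g.quotKerEquivOfSurjective h.surj).symm.toLinearMap,
    fun b => ?_⟩
  have : (g.quotKerEquivOfSurjective h.surj).symm (g b) = Submodule.Quotient.mk b := by
    rw [LinearEquiv.symm_apply_eq]
    rfl
  simp [this]

theorem exists_lift {f : A →ₗ[R] B} {g : B →ₗ[R] C} (h : IsSES f g) (k : N →ₗ[R] B)
    (hk : ∀ a, g (k a) = 0) : ∃ k' : N →ₗ[R] A, ∀ a, f (k' a) = k a := by
  refine ⟨(LinearEquiv.ofInjective f h.inj).symm.toLinearMap.comp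
    (k.codRestrict (LinearMap.range f) fun a => (h.exact _).1 (hk a)), fun a => ?_⟩
  exact congrArg Subtype.val ((LinearEquiv.ofInjective f h.inj).apply_symm_apply _)

theorem mkQ {f : A →ₗ[R] B} (hf : Function.Injective f) :
    IsSES f (LinearMap.range f).mkQ :=
  ⟨hf, Submodule.mkQ_surjective _, f.exact_map_mkQ_range⟩

theorem subtype {g : B →ₗ[R] C} (hg : Function.Surjective g) :
    IsSES (LinearMap.ker g).subtype g :=
  ⟨Subtype.val_injective, hg, g.exact_subtype_ker_map⟩

theorem prod : IsSES (LinearMap.inl R A B) (LinearMap.snd R A B) :=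
  ⟨LinearMap.inl_injective, LinearMap.snd_surjective, Function.Exact.inl_snd⟩

theorem prod' : IsSES (LinearMap.inr R A B) (LinearMap.fst R A B) :=
  ⟨LinearMap.inr_injective, LinearMap.fst_surjective, Function.Exact.inr_fst⟩

theorem of_equiv (e : A ≃ₗ[R] B) : IsSES e.toLinearMap (0 : B →ₗ[R] PUnit.{u + 1}) :=
  ⟨e.injective, fun x => ⟨0, Subsingleton.elim _ _⟩, fun b => by simp⟩

theorem of_equiv' (e : A ≃ₗ[R] B) : IsSES (0 : PUnit.{u + 1} →ₗ[R] A) e.toLinearMap :=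
  ⟨fun _ _ _ => Subsingleton.elim _ _, e.surjective, fun b => by simp [eq_comm (a := (0 : A))]⟩

theorem comp_equiv {f : A →ₗ[R] B} {g : B →ₗ[R] C} (h : IsSES f g) (e : N ≃ₗ[R] A) :
    IsSES (f.comp e.toLinearMap) g :=
  ⟨h.inj.comp e.injective, h.surj, fun b => by
    rw [h.exact b]
    exact ⟨fun ⟨a, ha⟩ => ⟨e.symm a, by simpa using ha⟩, fun ⟨a, ha⟩ => ⟨e a, ha⟩⟩⟩

theorem equiv_comp {f : A →ₗ[R] B} {g : B →ₗ[R] C} (h : IsSES f g) (e : C ≃ₗ[R] N) :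
    IsSES f (e.toLinearMap.comp g) :=
  ⟨h.inj, e.surjective.comp h.surj, fun b => by
    rw [← h.exact b]
    simp⟩

variable {A' B' C' A'' B'' C'' : Type u} [AddCommGroup A'] [AddCommGroup B'] [AddCommGroup C']
  [AddCommGroup A''] [AddCommGroup B''] [AddCommGroup C''] [Module R A'] [Module R B']
  [Module R C'] [Module R A''] [Module R B''] [Module R C'']

/-- The cokernels of an injective map of short exact sequences form a short exact sequence. -/
theorem coker {f : A' →ₗ[R] A} {g : A →ₗ[R] A''} {f₂ : B' →ₗ[R] B} {g₂ : B →ₗ[R] B''}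
    {a' : A' →ₗ[R] B'} {c' : B' →ₗ[R] C'} {a : A →ₗ[R] B} {c : B →ₗ[R] C}
    {a'' : A'' →ₗ[R] B''} {c'' : B'' →ₗ[R] C''}
    (h : IsSES f g) (h₂ : IsSES f₂ g₂) (k' : IsSES a' c') (k : IsSES a c) (k'' : IsSES a'' c'')
    (hf : ∀ x, f₂ (a' x) = a (f x)) (hg : ∀ x, g₂ (a x) = a'' (g x)) :
    ∃ (φ : C' →ₗ[R] C) (ψ : C →ₗ[R] C''), IsSES φ ψ := by
  obtain ⟨φ, hφ⟩ := k'.exists_desc (c.comp f₂) fun x => by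
    simp [hf, k.exact.apply_apply_eq_zero]
  obtain ⟨ψ, hψ⟩ := k.exists_desc (c''.comp g₂) fun x => by
    simp [hg, k''.exact.apply_apply_eq_zero]
  simp only [LinearMap.comp_apply] at hφ hψ
  refine ⟨φ, ψ, ?_, ?_, ?_⟩
  · rw [injective_iff_map_eq_zero]
    intro x hx
    obtain ⟨b', rfl⟩ := k'.surj x
    rw [hφ] at hx
    obtain ⟨y, hy⟩ := (k.exact _).1 hx
    have h0 : a'' (g y) = 0 := by rw [← hg, hy, h₂.exact.apply_apply_eq_zero]
    obtain ⟨z, rfl⟩ := (h.exact y).1 (k''.inj (by rw [h0, map_zero]))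
    rw [← hf] at hy
    rw [← h₂.inj hy, k'.exact.apply_apply_eq_zero]
  · intro z
    obtain ⟨y, rfl⟩ := k''.surj z
    obtain ⟨x, rfl⟩ := h₂.surj y
    exact ⟨c x, hψ x⟩
  · intro y
    obtain ⟨b, rfl⟩ := k.surj y
    constructor
    · intro hb
      rw [hψ] at hb
      obtain ⟨z, hz⟩ := (k''.exact _).1 hb
      obtain ⟨y, rfl⟩ := h.surj z
      obtain ⟨b', hb'⟩ := (h₂.exact (b - a y)).1 (by rw [map_sub, hg, hz, sub_self])
      refine ⟨c' b', ?_⟩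
      rw [hφ, hb', map_sub, k.exact.apply_apply_eq_zero, sub_zero]
    · rintro ⟨x, hx⟩
      obtain ⟨b', rfl⟩ := k'.surj x
      rw [← hx, hφ, hψ, h₂.exact.apply_apply_eq_zero, map_zero]

/-- The kernels of a surjective map of short exact sequences form a short exact sequence. -/
theorem ker {f : C' →ₗ[R] C} {g : C →ₗ[R] C''} {f₂ : B' →ₗ[R] B} {g₂ : B →ₗ[R] B''}
    {a' : A' →ₗ[R] B'} {c' : B' →ₗ[R] C'} {a : A →ₗ[R] B} {c : B →ₗ[R] C}
    {a'' : A'' →ₗ[R] B''} {c'' : B'' →ₗ[R] C''}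
    (h : IsSES f g) (h₂ : IsSES f₂ g₂) (k' : IsSES a' c') (k : IsSES a c) (k'' : IsSES a'' c'')
    (hf : ∀ x, f (c' x) = c (f₂ x)) (hg : ∀ x, g (c x) = c'' (g₂ x)) :
    ∃ (φ : A' →ₗ[R] A) (ψ : A →ₗ[R] A''), IsSES φ ψ := by
  obtain ⟨φ, hφ⟩ := k.exists_lift (f₂.comp a') fun x => by
    simp [← hf, k'.exact.apply_apply_eq_zero]
  obtain ⟨ψ, hψ⟩ := k''.exists_lift (g₂.comp a) fun x => by
    simp [← hg, k.exact.apply_apply_eq_zero]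
  simp only [LinearMap.comp_apply] at hφ hψ
  refine ⟨φ, ψ, ?_, ?_, ?_⟩
  · intro x y hxy
    apply k'.inj
    apply h₂.inj
    rw [← hφ, ← hφ, hxy]
  · intro z
    obtain ⟨y, hy⟩ := h₂.surj (a'' z)
    obtain ⟨m, hm⟩ := (h.exact (c y)).1 (by rw [hg, hy, k''.exact.apply_apply_eq_zero])
    obtain ⟨w, rfl⟩ := k'.surj m
    obtain ⟨x, hx⟩ := (k.exact (y - f₂ w)).1 (by rw [map_sub, ← hf, hm, sub_self])
    refine ⟨x, k''.inj ?_⟩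
    rw [hψ, hx, map_sub, h₂.exact.apply_apply_eq_zero, sub_zero, hy]
  · intro x
    constructor
    · intro hx
      obtain ⟨y, hy⟩ := (h₂.exact (a x)).1 (by rw [← hψ, hx, map_zero])
      obtain ⟨z, rfl⟩ := (k'.exact y).1 (h.inj (by
        rw [hf, hy, k.exact.apply_apply_eq_zero, map_zero]))
      exact ⟨z, k.inj (by rw [hφ, hy])⟩
    · rintro ⟨z, rfl⟩
      apply k''.inj
      rw [hψ, hφ, h₂.exact.apply_apply_eq_zero, map_zero]

/-- The third isomorphism theorem: `A ⊆ B ⊆ C` gives `0 → B/A → C/A → C/B → 0`. -/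
theorem third {i : A →ₗ[R] B} {p : B →ₗ[R] A'} {j : B →ₗ[R] C} {q : C →ₗ[R] B'}
    {r : C →ₗ[R] C'} (h : IsSES i p) (k : IsSES j q) (l : IsSES (j.comp i) r) :
    ∃ (φ : A' →ₗ[R] C') (ψ : C' →ₗ[R] B'), IsSES φ ψ :=
  coker (of_equiv (LinearEquiv.refl R A)) k h l
    (of_equiv' (LinearEquiv.refl R B')) (fun _ => rfl)
    fun x => by simp [k.exact.apply_apply_eq_zero]

/-- The pushout of two injections with a common source. -/
theorem pushout {i : A →ₗ[R] B} {p : B →ₗ[R] B'} {j : A →ₗ[R] C} {q : C →ₗ[R] C'}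
    (h : IsSES i p) (k : IsSES j q) :
    ∃ (X : ModuleCat.{u} R) (b : B →ₗ[R] X) (q' : X →ₗ[R] C') (c : C →ₗ[R] X)
      (p' : X →ₗ[R] B'), IsSES b q' ∧ IsSES c p' := by
  have hinj : Function.Injective (LinearMap.prod (-i) j) := fun x y hxy =>
    k.inj (congrArg Prod.snd hxy)
  obtain ⟨b, q', hb⟩ := coker (of_equiv' (LinearEquiv.refl R A)) prod
    (of_equiv' (LinearEquiv.refl R B)) (mkQ hinj) k (fun _ => by simp) fun _ => rfl
  obtain ⟨c, p', hc⟩ := coker (of_equiv' (LinearEquiv.neg R (M := A))) prod'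
    (of_equiv' (LinearEquiv.refl R C)) (mkQ hinj) h (fun _ => by simp) fun _ => by simp
  exact ⟨ModuleCat.of R _, b, q', c, p', hb, hc⟩

end Diagrams

end IsSES

section Ext

variable {R : Type u} [Ring R]

/-- Vanishing of `Ext^i_R(M, N)`. -/
def ExtZero (R : Type u) [Ring R] (M N : Type u) [AddCommGroup M] [AddCommGroup N] [Module R M]
    [Module R N] (i : ℕ) : Prop :=
  ∀ e : Ext (ModuleCat.of R M) (ModuleCat.of R N) i, e = 0

variable {A B C N : Type u} [AddCommGroup A] [AddCommGroup B] [AddCommGroup C] [AddCommGroup N]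
  [Module R A] [Module R B] [Module R C] [Module R N]

/-- The short complex in `ModuleCat R` attached to a short exact sequence. -/
abbrev IsSES.toShortComplex {f : A →ₗ[R] B} {g : B →ₗ[R] C} (h : IsSES f g) :
    ShortComplex (ModuleCat.{u} R) :=
  ModuleCat.shortComplexOfCompEqZero f g h.exact.linearMap_comp_eq_zero

theorem IsSES.shortExact {f : A →ₗ[R] B} {g : B →ₗ[R] C} (h : IsSES f g) :
    h.toShortComplex.ShortExact :=
  ModuleCat.shortComplex_shortExact _ h.exact h.inj h.surj

namespace ExtZero

theorem of_projective [Module.Projective R A] (i : ℕ) : ExtZero R A N (i + 1) := fun e => by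
  have : CategoryTheory.Projective (ModuleCat.of R A) :=
    (IsProjective.iff_projective (R := R) A).1 inferInstance
  exact e.eq_zero_of_projective

theorem right {f : A →ₗ[R] B} {g : B →ₗ[R] C} (h : IsSES f g) {i : ℕ} (hA : ExtZero R A N i)
    (hB : ExtZero R B N (i + 1)) : ExtZero R C N (i + 1) := fun e => by
  obtain ⟨x, rfl⟩ := Ext.contravariant_sequence_exact₃ h.shortExact _ e (hB _) (add_comm 1 i)
  rw [hA x, Ext.comp_zero]

theorem left {f : A →ₗ[R] B} {g : B →ₗ[R] C} (h : IsSES f g) {i : ℕ}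
    (hC : ExtZero R C N (i + 1)) (hB : ExtZero R B N i) : ExtZero R A N i := fun e => by
  obtain ⟨x, rfl⟩ := Ext.contravariant_sequence_exact₁ h.shortExact _ e (add_comm 1 i) (hC _)
  rw [hB x, Ext.comp_zero]

theorem middle {f : A →ₗ[R] B} {g : B →ₗ[R] C} (h : IsSES f g) {i : ℕ}
    (hA : ExtZero R A N i) (hC : ExtZero R C N i) : ExtZero R B N i := fun e => by
  obtain ⟨x, rfl⟩ := Ext.contravariant_sequence_exact₂ h.shortExact _ e (hA _)
  rw [hC x, Ext.comp_zero]

theorem of_equiv (e : A ≃ₗ[R] B) {i : ℕ} (hA : ExtZero R A N (i + 1)) :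
    ExtZero R B N (i + 1) :=
  middle (IsSES.of_equiv e) hA (of_projective i)

/-- If `Ext¹(C, N) = 0` then maps `A → N` extend to `B`. -/
theorem exists_extension {f : A →ₗ[R] B} {g : B →ₗ[R] C} (h : IsSES f g)
    (hC : ExtZero R C N 1) (k : A →ₗ[R] N) : ∃ l : B →ₗ[R] N, ∀ a, l (f a) = k a := by
  obtain ⟨x, hx⟩ := Ext.contravariant_sequence_exact₁ h.shortExact _
    (Ext.mk₀ (ModuleCat.ofHom k)) (add_zero 1) (hC _)
  obtain ⟨l, rfl⟩ := Ext.homEquiv₀.symm.surjective x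
  rw [Ext.homEquiv₀_symm_apply, Ext.mk₀_comp_mk₀] at hx
  have h2 := Ext.homEquiv₀.symm.injective hx
  exact ⟨l.hom, fun a => congrArg (fun t => t.hom a) h2⟩

/-- If maps `A → N` extend to `B` and `Ext¹(B, N) = 0`, then `Ext¹(C, N) = 0`. -/
theorem one_of_extension {f : A →ₗ[R] B} {g : B →ₗ[R] C} (h : IsSES f g)
    (hB : ExtZero R B N 1) (hk : ∀ k : A →ₗ[R] N, ∃ l : B →ₗ[R] N, ∀ a, l (f a) = k a) :
    ExtZero R C N 1 := fun e => by
  obtain ⟨x, rfl⟩ := Ext.contravariant_sequence_exact₃ h.shortExact _ e (hB _) (add_zero 1)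
  obtain ⟨k, rfl⟩ := Ext.homEquiv₀.symm.surjective x
  obtain ⟨l, hl⟩ := hk k.hom
  have : k = h.toShortComplex.f ≫ ModuleCat.ofHom l := by
    ext a
    exact (hl a).symm
  rw [Ext.homEquiv₀_symm_apply, this, ← Ext.mk₀_comp_mk₀,
    h.shortExact.extClass_comp_assoc]

end ExtZero

end Ext

theorem IsSES.exists_section {R : Type u} [Ring R] {A B C : Type u} [AddCommGroup A]
    [AddCommGroup B] [AddCommGroup C] [Module R A] [Module R B] [Module R C] {f : A →ₗ[R] B}
    {g : B →ₗ[R] C} (h : IsSES f g) [Module.Injective R A] :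
    ∃ s : C →ₗ[R] B, ∀ c, g (s c) = c := by
  obtain ⟨ρ, hρ⟩ := Module.Injective.out f h.inj (LinearMap.id : A →ₗ[R] A)
  obtain ⟨s, hs⟩ := h.exists_desc (LinearMap.id - f.comp ρ) fun a => by simp [hρ]
  refine ⟨s, fun c => ?_⟩
  obtain ⟨b, rfl⟩ := h.surj c
  simp [hs, h.exact.apply_apply_eq_zero]

theorem exists_projective_cover (R : Type u) [Ring R] (M : Type u) [AddCommGroup M]
    [Module R M] : ∃ (K P : ModuleCat.{u} R) (f : K →ₗ[R] P) (g : P →ₗ[R] M),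
      Module.Projective R P ∧ IsSES f g :=
  ⟨ModuleCat.of R _, ModuleCat.of R (M →₀ R), _, Finsupp.linearCombination R id,
    inferInstanceAs (Module.Projective R (M →₀ R)),
    IsSES.subtype (Finsupp.linearCombination_id_surjective R M)⟩

section FlatDimension

variable (R S : Type u) [Ring R] [Ring S] [OppRing R S]

/-- `M` has flat dimension at most `n`, in the form: the character dual of `M` has injective
dimension at most `n`. -/
def FdLE (n : ℕ) (M : Type u) [AddCommGroup M] [Module R M] : Prop :=
  HasInjectiveDimensionLT (ModuleCat.of S (CharDual R S M)) (n + 1)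

namespace FdLE

variable {R S}
variable {A B C : Type u} [AddCommGroup A] [AddCommGroup B] [AddCommGroup C]
  [Module R A] [Module R B] [Module R C] {f : A →ₗ[R] B} {g : B →ₗ[R] C} {n : ℕ}

theorem zero_iff : FdLE R S 0 A ↔ Module.Injective S (CharDual R S A) := by
  rw [Module.injective_iff_injective_object, injective_iff_hasInjectiveDimensionLT_one, FdLE]

theorem succ (h : FdLE R S n A) : FdLE R S (n + 1) A := by
  rw [FdLE] at *
  exact hasInjectiveDimensionLT_of_ge _ (n + 1) _ (Nat.le_succ _)

theorem of_zero (h : FdLE R S 0 A) : FdLE R S n A := by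
  induction n with
  | zero => exact h
  | succ n ih => exact ih.succ

theorem left (h : IsSES f g) (hB : FdLE R S n B) (hC : FdLE R S (n + 1) C) : FdLE R S n A :=
  (CharDual.map_isSES (S := S) h).shortExact.hasInjectiveDimensionLT_X₃ (n + 1) hB hC

theorem middle (h : IsSES f g) (hA : FdLE R S n A) (hC : FdLE R S n C) : FdLE R S n B :=
  (CharDual.map_isSES (S := S) h).shortExact.hasInjectiveDimensionLT_X₂ (n + 1) hC hA

theorem right (h : IsSES f g) (hA : FdLE R S n A) (hB : FdLE R S (n + 1) B) :
    FdLE R S (n + 1) C :=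
  (CharDual.map_isSES (S := S) h).shortExact.hasInjectiveDimensionLT_X₁ (n + 1) hA hB

/-- Flat dimension does not increase under passing to a module whose dual is a retract. -/
theorem of_dual_retract (hB : FdLE R S n B) (i : CharDual R S A →ₗ[S] CharDual R S B)
    (r : CharDual R S B →ₗ[S] CharDual R S A) (h : ∀ x, r (i x) = x) : FdLE R S n A := by
  rw [FdLE] at *
  exact Retract.hasInjectiveDimensionLT
    { i := ModuleCat.ofHom i, r := ModuleCat.ofHom r, retract := ModuleCat.hom_ext (LinearMap.ext h) } (n + 1)

theorem of_retract (hB : FdLE R S n B) (i : A →ₗ[R] B) (r : B →ₗ[R] A)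
    (h : ∀ x, r (i x) = x) : FdLE R S n A :=
  hB.of_dual_retract (CharDual.map S r) (CharDual.map S i) fun φ =>
    CharDual.ext fun a => by simp [h]

theorem of_projective [Module.Projective R A] : FdLE R S n A := by
  refine of_zero (zero_iff.2 ⟨fun X Y _ _ _ _ f hf g => ?_⟩)
  obtain ⟨l, hl⟩ := Module.projective_lifting_property (CharDual.map R f)
    (CharDual.swap (R := S) (S := R) g) (CharDual.map_surjective hf)
  refine ⟨CharDual.swap l, fun x => CharDual.ext fun a => ?_⟩
  exact DFunLike.congr_fun (LinearMap.congr_fun hl a) x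

/-- Maps into character duals extend along short exact sequences with flat cokernel. -/
theorem exists_extension (h : IsSES f g) (hC : FdLE R S 0 C) {N : Type u} [AddCommGroup N]
    [Module S N] (k : A →ₗ[R] CharDual S R N) :
    ∃ l : B →ₗ[R] CharDual S R N, ∀ a, l (f a) = k a := by
  have := zero_iff.1 hC
  obtain ⟨s, hs⟩ := (CharDual.map_isSES (S := S) h).exists_section
  refine ⟨CharDual.swap (R := S) (S := R) (s.comp (CharDual.swap k)), fun a =>
    CharDual.ext fun x => ?_⟩
  exact DFunLike.congr_fun (hs (CharDual.swap k x)) a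

theorem extZero (hC : FdLE R S 0 C) (N : Type u) [AddCommGroup N] [Module S N] (i : ℕ) :
    ExtZero R C (CharDual S R N) (i + 1) := by
  induction i generalizing C with
  | zero =>
    obtain ⟨K, P, f, g, hP, h⟩ := exists_projective_cover R C
    exact ExtZero.one_of_extension h (ExtZero.of_projective 0) fun k => hC.exists_extension h k
  | succ i ih =>
    obtain ⟨K, P, f, g, hP, h⟩ := exists_projective_cover R C
    exact ExtZero.right h (ih (left h of_projective hC.succ)) (ExtZero.of_projective _)

end FdLE

end FlatDimension

section Coherent

variable {R S : Type u} [Ring R] [Ring S] [OppRing R S]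

theorem CharDual.toOp_smul_apply {I : Type u} [AddCommGroup I] [Module S I]
    (s : S) (x : CharDual S R I) (m : I) :
    (unop (OppRing.toOp (R := R) s) • x) m = x (s • m) := by
  change x (unop (OppRing.fromOp (S := S) (unop (OppRing.toOp (R := R) s))) • m) = _
  rw [OppRing.fromOp_toOp, unop_op]

/-- If the left ideal generated by the `j i` is finitely presented, the image of
`y ↦ (j i • y)` is cut out by finitely many linear equations in every injective module. -/
theorem exists_equations {ι : Type u} [Fintype ι] (j : ι → S)
    (hj : Module.FinitePresentation S (Submodule.span S (Set.range j)))
    (I : Type u) [AddCommGroup I] [Module S I] [Module.Injective S I] :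
    ∃ t : Finset (ι → S), (∀ a ∈ t, ∑ i, a i * j i = 0) ∧
      ∀ y : ι → I, (∀ a ∈ t, ∑ i, a i • y i = 0) → ∃ y₀ : I, ∀ i, y i = j i • y₀ := by
  classical
  let J := Submodule.span S (Set.range j)
  have hmem : ∀ c : ι → S, Fintype.linearCombination S j c ∈ J := fun c => by
    rw [Fintype.linearCombination_apply]
    exact Submodule.sum_mem _ fun i _ => Submodule.smul_mem _ _ (Submodule.subset_span ⟨i, rfl⟩)
  let l : (ι → S) →ₗ[S] J := (Fintype.linearCombination S j).codRestrict J hmem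
  have hl : Function.Surjective l := fun x => by
    have hx : (x : S) ∈ Submodule.span S (Set.range j) := x.2
    rw [← Fintype.range_linearCombination S j] at hx
    obtain ⟨c, hc⟩ := hx
    exact ⟨c, Subtype.ext hc⟩
  obtain ⟨t, ht⟩ := Module.FinitePresentation.fg_ker l hl
  refine ⟨t, fun a ha => ?_, fun y hy => ?_⟩
  · have : a ∈ LinearMap.ker l := ht ▸ Submodule.subset_span ha
    simpa [l, Fintype.linearCombination_apply, Subtype.ext_iff] using this
  · have hker : LinearMap.ker l ≤ LinearMap.ker (Fintype.linearCombination S y) := by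
      rw [← ht, Submodule.span_le]
      intro a ha
      simpa [Fintype.linearCombination_apply] using hy a ha
    obtain ⟨k, hk⟩ := (IsSES.subtype hl).exists_desc (Fintype.linearCombination S y)
      fun a => hker a.2
    obtain ⟨k', hk'⟩ := Module.Injective.out J.subtype Subtype.val_injective k
    refine ⟨k' 1, fun i => ?_⟩
    have h1 := hk (Pi.single i 1)
    rw [← hk' (l _)] at h1
    have h2 : J.subtype (l (Pi.single i 1)) = j i := by
      simp [l, Fintype.linearCombination_apply_single]
    rw [h2, Fintype.linearCombination_apply_single, one_smul] at h1
    rw [← h1, ← map_smul, smul_eq_mul, mul_one]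

/-- The equational form of the injectivity of the double dual. -/
theorem sum_apply_eq_zero_of_coherent (hS : IsLeftCoherent S) {I : Type u} [AddCommGroup I]
    [Module S I] [Module.Injective S I] {J : Ideal S}
    (φ : J →ₗ[S] CharDual R S (CharDual S R I)) {ι : Type u} [Fintype ι] (j : ι → J)
    (x : ι → CharDual S R I)
    (h : ∑ i, unop (OppRing.toOp (R := R) (j i : S)) • x i = 0) : ∑ i, φ (j i) (x i) = 0 := by
  classical
  obtain ⟨t, ht, ht'⟩ := exists_equations (fun i => (j i : S))
    (hS _ (Submodule.fg_span (Set.finite_range _))) I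
  let f : I →+ (ι → I) :=
    AddMonoidHom.mk' (fun y i => (j i : S) • y) fun y z => by ext; simp
  let g : (ι → I) →+ (t → I) :=
    AddMonoidHom.mk' (fun y a => ∑ i, (a : ι → S) i • y i) fun y z => by
      ext; simp [Finset.sum_add_distrib]
  have hfg : Function.Exact f g := fun y => by
    constructor
    · intro hy
      obtain ⟨y₀, hy₀⟩ := ht' y fun a ha => congrFun hy ⟨a, ha⟩
      exact ⟨y₀, funext fun i => (hy₀ i).symm⟩
    · rintro ⟨y₀, rfl⟩
      ext a
      simp only [f, g, AddMonoidHom.mk'_apply, smul_smul, ← Finset.sum_smul, ht a a.2, zero_smul,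
        Pi.zero_apply]
  let χ : (ι → I) →+ AddCircle (1 : ℚ) :=
    AddMonoidHom.mk' (fun y => ∑ i, x i (y i)) fun y z => by
      simp [Finset.sum_add_distrib]
  obtain ⟨ψ, hψ⟩ := exists_character_comp_eq hfg χ fun y => by
    have := DFunLike.congr_fun h y
    rw [CharDual.sum_apply, CharDual.zero_apply] at this
    simp only [CharDual.toOp_smul_apply] at this
    exact this
  let w : t → CharDual S R I := fun a => ψ.comp (AddMonoidHom.single (fun _ : t => I) a)
  have hx : ∀ i, x i = ∑ a : t, unop (OppRing.toOp (R := R) ((a : ι → S) i)) • w a := by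
    intro i
    ext y
    have h1 : χ (Pi.single i y) = x i y := by
      change ∑ i', x i' ((Pi.single i y : ι → I) i') = _
      rw [Finset.sum_eq_single i (fun i' _ hi => by rw [Pi.single_eq_of_ne hi, map_zero])
        (by simp), Pi.single_eq_same]
    have h2 : g (Pi.single i y) = ∑ a : t, Pi.single a ((a : ι → S) i • y) := by
      rw [Finset.univ_sum_single fun a : t => (a : ι → S) i • y]
      ext a
      change ∑ i', (a : ι → S) i' • ((Pi.single i y : ι → I) i') = _
      rw [Finset.sum_eq_single i (fun i' _ hi => by rw [Pi.single_eq_of_ne hi, smul_zero])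
        (by simp), Pi.single_eq_same]
    rw [← h1, ← hψ, h2, map_sum, CharDual.sum_apply]
    refine Finset.sum_congr rfl fun a _ => ?_
    rw [CharDual.toOp_smul_apply]
    rfl
  calc ∑ i, φ (j i) (x i)
      = ∑ i, ∑ a : t, ((a : ι → S) i • φ (j i)) (w a) := by
        refine Finset.sum_congr rfl fun i _ => ?_
        rw [hx i, map_sum]
        rfl
    _ = ∑ a : t, (φ (∑ i, (a : ι → S) i • j i)) (w a) := by
        rw [Finset.sum_comm]
        refine Finset.sum_congr rfl fun a _ => ?_
        rw [map_sum, CharDual.sum_apply]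
        simp only [LinearMap.map_smul]
    _ = 0 := by
        refine Finset.sum_eq_zero fun a _ => ?_
        have : ∑ i, (a : ι → S) i • j i = 0 := Subtype.ext (by simpa using ht a a.2)
        rw [this, map_zero, CharDual.zero_apply]

/-- Over a coherent ring, the double character dual of an injective module is injective. -/
theorem injective_double_dual (hS : IsLeftCoherent S) (I : Type u) [AddCommGroup I] [Module S I]
    [Module.Injective S I] :
    Module.Injective S (CharDual R S (CharDual S R I)) := by
  refine Module.Baer.injective fun J φ => ?_
  let T : (J →₀ CharDual S R I) →+ CharDual S R I := Finsupp.liftAddHom fun j =>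
    DistribSMul.toAddMonoidHom _ (unop (OppRing.toOp (R := R) (j : S)))
  let Φ : (J →₀ CharDual S R I) →+ AddCircle (1 : ℚ) := Finsupp.liftAddHom fun j => φ j
  have hT : Function.Exact T.ker.subtype T := fun z => by simp [AddMonoidHom.mem_ker]
  obtain ⟨χ, hχ⟩ := exists_character_comp_eq hT Φ fun z => by
    have hz := z.2
    rw [AddMonoidHom.mem_ker, Finsupp.liftAddHom_apply, Finsupp.sum, ← Finset.sum_coe_sort] at hz
    have := sum_apply_eq_zero_of_coherent hS φ (fun i : z.1.support => (i : J))
      (fun i => z.1 i) hz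
    rw [Finset.sum_coe_sort z.1.support fun i => φ i (z.1 i)] at this
    exact this
  refine ⟨LinearMap.toSpanSingleton S _ (show CharDual R S (CharDual S R I) from χ),
    fun s hs => CharDual.ext fun x => ?_⟩
  have h1 := hχ (Finsupp.single ⟨s, hs⟩ x)
  have h2 : Φ (Finsupp.single ⟨s, hs⟩ x) = φ ⟨s, hs⟩ x :=
    Finsupp.liftAddHom_apply_single (N := AddCircle (1 : ℚ)) _ _ _
  rw [h2] at h1
  simp only [T, Finsupp.liftAddHom_apply_single] at h1
  exact h1

/-- Over a coherent ring, the double character dual of a flat module is flat. -/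
theorem FdLE.double_dual (hS : IsLeftCoherent S) {F : Type u} [AddCommGroup F] [Module R F]
    (hF : FdLE R S 0 F) : FdLE R S 0 (CharDual S R (CharDual R S F)) := by
  have := FdLE.zero_iff.1 hF
  exact FdLE.zero_iff.2 (injective_double_dual hS (CharDual R S F))

end Coherent

theorem exact_of_characters {A B C : Type*} [AddCommGroup A] [AddCommGroup B]
    [AddCommGroup C] {f : A →+ B} {g : B →+ C} (h₀ : ∀ a, g (f a) = 0)
    (h : ∀ χ : B →+ AddCircle (1 : ℚ), (∀ a, χ (f a) = 0) →
      ∃ ψ : C →+ AddCircle (1 : ℚ), ∀ b, ψ (g b) = χ b) : Function.Exact f g := by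
  refine fun b => ⟨fun hb => ?_, ?_⟩
  · have : (b : B ⧸ f.range) = 0 := eq_zero_of_forall_character fun φ => by
      obtain ⟨ψ, hψ⟩ := h (φ.comp (QuotientAddGroup.mk' f.range)) fun a => by
        have : (QuotientAddGroup.mk' f.range) (f a) = 0 :=
          (QuotientAddGroup.eq_zero_iff _).2 ⟨a, rfl⟩
        rw [AddMonoidHom.comp_apply, this, map_zero]
      have h1 := hψ b
      rw [hb, map_zero] at h1
      exact h1.symm
    exact (QuotientAddGroup.eq_zero_iff b).1 this
  · rintro ⟨a, rfl⟩
    exact h₀ a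

theorem Module.Injective.of_smul_eq {S T I : Type u} [Ring S] [Ring T] (e : S ≃+* T)
    [AddCommGroup I] [Module S I] [Module T I] (hc : ∀ (s : S) (a : I), s • a = e s • a)
    (h : Module.Injective S I) : Module.Injective T I where
  out X Y _ _ _ _ f hf g := by
    let _ : Module S X := Module.compHom X e.toRingHom
    let _ : Module S Y := Module.compHom Y e.toRingHom
    obtain ⟨l, hl⟩ := h.out (X := X) (Y := Y) ⟨⟨f, map_add f⟩, fun s x => f.map_smul (e s) x⟩ hf
      ⟨⟨g, map_add g⟩, fun s x => (g.map_smul (e s) x).trans (hc s (g x)).symm⟩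
    refine ⟨⟨⟨l, map_add l⟩, fun t y => ?_⟩, hl⟩
    obtain ⟨s, rfl⟩ := e.surjective t
    exact (l.map_smul s y).trans (hc s (l y))

namespace NTensor

section Characters

variable {R : Type u} [Ring R]
variable {A B : Type u} [AddCommGroup A] [Module Rᵐᵒᵖ A] [AddCommGroup B] [Module Rᵐᵒᵖ B]
variable {M N : Type u} [AddCommGroup M] [Module R M] [AddCommGroup N] [Module R N]

/-- The pure tensor `a ⊗ m`. -/
def tmul (a : A) (m : M) : NTensor R A M :=
  QuotientAddGroup.mk (s := tensorRels R A M) (FreeAbelianGroup.of (a, m))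

theorem sub_eq_zero_of_mem {x y : FreeAbelianGroup (A × M)} (h : x - y ∈ tensorRels R A M) :
    (QuotientAddGroup.mk (s := tensorRels R A M) x) = QuotientAddGroup.mk y := by
  rw [← sub_eq_zero, ← QuotientAddGroup.mk_sub]
  exact (QuotientAddGroup.eq_zero_iff _).2 h

theorem add_tmul (a b : A) (m : M) :
    (tmul (a + b) m : NTensor R A M) = tmul a m + tmul b m :=
  sub_eq_zero_of_mem (y := FreeAbelianGroup.of (a, m) + FreeAbelianGroup.of (b, m)) (by
    rw [← sub_sub]
    exact AddSubgroup.subset_closure (Or.inl ⟨a, b, m, rfl⟩))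

theorem tmul_add (a : A) (m n : M) :
    (tmul a (m + n) : NTensor R A M) = tmul a m + tmul a n :=
  sub_eq_zero_of_mem (y := FreeAbelianGroup.of (a, m) + FreeAbelianGroup.of (a, n)) (by
    rw [← sub_sub]
    exact AddSubgroup.subset_closure (Or.inr (Or.inl ⟨a, m, n, rfl⟩)))

theorem smul_tmul (r : R) (a : A) (m : M) :
    (tmul (op r • a) m : NTensor R A M) = tmul a (r • m) :=
  sub_eq_zero_of_mem (AddSubgroup.subset_closure (Or.inr (Or.inr ⟨a, r, m, rfl⟩)))

theorem rmap_tmul (g : M →ₗ[R] N) (a : A) (m : M) : rmap A g (tmul a m) = tmul a (g m) := by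
  change QuotientAddGroup.mk (FreeAbelianGroup.map _ (FreeAbelianGroup.of (a, m))) = _
  rw [FreeAbelianGroup.map_of_apply]
  rfl

theorem lmap_tmul (f : A →ₗ[Rᵐᵒᵖ] B) (a : A) (m : M) : lmap M f (tmul a m) = tmul (f a) m := by
  change QuotientAddGroup.mk (FreeAbelianGroup.map _ (FreeAbelianGroup.of (a, m))) = _
  rw [FreeAbelianGroup.map_of_apply]
  rfl

theorem hom_ext {G : Type*} [AddCommGroup G] {f g : NTensor R A M →+ G}
    (h : ∀ a m, f (tmul a m) = g (tmul a m)) : f = g := by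
  refine QuotientAddGroup.addMonoidHom_ext _ (FreeAbelianGroup.lift_ext _ _ fun p => ?_)
  exact h p.1 p.2

variable {S : Type u} [Ring S] [OppRing R S] [Module S A]

/-- Characters of `A ⊗ M` are the linear maps from `M` to the dual of `A`. -/
theorem exists_character (hc : ∀ (s : S) (a : A), s • a = OppRing.toOp (R := R) s • a)
    (b : M →ₗ[R] CharDual S R A) :
    ∃ χ : NTensor R A M →+ AddCircle (1 : ℚ), ∀ a m, χ (tmul a m) = b m a := by
  refine ⟨QuotientAddGroup.lift (tensorRels R A M)
    (FreeAbelianGroup.lift fun p : A × M => b p.2 p.1) ?_, fun a m =>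
      FreeAbelianGroup.lift_apply_of _ _⟩
  rw [tensorRels, AddSubgroup.closure_le]
  rintro x (⟨a₁, a₂, m, rfl⟩ | ⟨a, m₁, m₂, rfl⟩ | ⟨a, r, m, rfl⟩)
  · simp
  · simp
  · have : b (r • m) a = b m (op r • a) := by
      rw [LinearMap.map_smul, CharDual.smul_apply, hc]
      change b m (OppRing.toOp (unop (OppRing.fromOp (S := S) r)) • a) = _
      rw [OppRing.toOp_fromOp]
    simp only [SetLike.mem_coe, AddMonoidHom.mem_ker, map_sub, FreeAbelianGroup.lift_apply_of]
    rw [this, sub_self]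

theorem exists_linearMap (hc : ∀ (s : S) (a : A), s • a = OppRing.toOp (R := R) s • a)
    (χ : NTensor R A M →+ AddCircle (1 : ℚ)) :
    ∃ b : M →ₗ[R] CharDual S R A, ∀ a m, b m a = χ (tmul a m) := by
  let b₀ (m : M) : CharDual S R A := AddMonoidHom.mk' (fun a => χ (tmul a m)) fun a a' => by
    rw [add_tmul, map_add]
  have hb₀ : ∀ m a, b₀ m a = χ (tmul a m) := fun _ _ => rfl
  refine ⟨⟨⟨b₀, fun m n => ?_⟩, fun r m => ?_⟩, fun a m => rfl⟩
  · ext a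
    rw [CharDual.add_apply, hb₀, hb₀, hb₀, tmul_add, map_add]
  · ext a
    rw [RingHom.id_apply, CharDual.smul_apply, hb₀, hb₀, hc]
    change _ = χ (tmul (OppRing.toOp (unop (OppRing.fromOp (S := S) r)) • a) m)
    rw [OppRing.toOp_fromOp, smul_tmul]

end Characters

end NTensor

section Flat

variable {R S : Type u} [Ring R] [Ring S] [OppRing R S]

theorem isFlatMod_iff (M : ModuleCat.{u} R) : IsFlatMod R M ↔ FdLE R S 0 M := by
  rw [FdLE.zero_iff]
  constructor
  · refine fun hM => ⟨fun A B _ _ _ _ f hf g => ?_⟩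
    let _ : Module Rᵐᵒᵖ A := Module.compHom A (OppRing.toOp (R := R) (S := S)).symm.toRingHom
    let _ : Module Rᵐᵒᵖ B := Module.compHom B (OppRing.toOp (R := R) (S := S)).symm.toRingHom
    have hA : ∀ (s : S) (a : A), s • a = OppRing.toOp (R := R) s • a := fun s a => by
      change _ = (OppRing.toOp (R := R) (S := S)).symm (OppRing.toOp (R := R) s) • a
      rw [RingEquiv.symm_apply_apply]
    have hB : ∀ (s : S) (a : B), s • a = OppRing.toOp (R := R) s • a := fun s a => by
      change _ = (OppRing.toOp (R := R) (S := S)).symm (OppRing.toOp (R := R) s) • a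
      rw [RingEquiv.symm_apply_apply]
    let f' : A →ₗ[Rᵐᵒᵖ] B :=
      ⟨⟨f, map_add f⟩, fun r a => f.map_smul ((OppRing.toOp (R := R) (S := S)).symm r) a⟩
    obtain ⟨χ, hχ⟩ := NTensor.exists_character hA (CharDual.swap (R := S) (S := R) g)
    obtain ⟨ψ, hψ⟩ := exists_character_extension (hM A B f' hf) χ
    obtain ⟨b, hb⟩ := NTensor.exists_linearMap hB ψ
    refine ⟨CharDual.swap b, fun a => CharDual.ext fun m => ?_⟩
    rw [CharDual.swap_apply, hb]
    change ψ (NTensor.tmul (f' a) m) = _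
    rw [← NTensor.lmap_tmul, hψ, hχ, CharDual.swap_apply]
  · intro hM A B _ _ _ _ f hf
    let _ : Module S A := Module.compHom A (OppRing.toOp (R := R) (S := S)).toRingHom
    let _ : Module S B := Module.compHom B (OppRing.toOp (R := R) (S := S)).toRingHom
    have hA : ∀ (s : S) (a : A), s • a = OppRing.toOp (R := R) s • a := fun _ _ => rfl
    have hB : ∀ (s : S) (a : B), s • a = OppRing.toOp (R := R) s • a := fun _ _ => rfl
    let f' : A →ₗ[S] B := ⟨⟨f, map_add f⟩, fun r a => f.map_smul (OppRing.toOp r) a⟩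
    rw [injective_iff_map_eq_zero]
    refine fun x hx => eq_zero_of_forall_character fun χ => ?_
    obtain ⟨b, hb⟩ := NTensor.exists_linearMap hA χ
    obtain ⟨l, hl⟩ := Module.Injective.out f' hf (CharDual.swap b)
    obtain ⟨ψ, hψ⟩ := NTensor.exists_character hB (CharDual.swap (R := S) (S := R) l)
    have : ψ.comp (NTensor.lmap M f) = χ := NTensor.hom_ext fun a m => by
      rw [AddMonoidHom.comp_apply, NTensor.lmap_tmul, hψ, ← hb, CharDual.swap_apply]
      exact DFunLike.congr_fun (hl a) m
    rw [← this, AddMonoidHom.comp_apply, hx, map_zero]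

variable (R S) in
/-- A class of modules, each of which embeds in a flat module and is a quotient of a flat module
with cokernel, resp. kernel, in the class, and which is left orthogonal to duals of injectives. -/
structure IsGFStable (𝒞 : ModuleCat.{u} R → Prop) : Prop where
  succ : ∀ K, 𝒞 K → ∃ (F C : ModuleCat.{u} R) (f : K →ₗ[R] F) (g : F →ₗ[R] C),
    IsSES f g ∧ FdLE R S 0 F ∧ 𝒞 C
  pred : ∀ K, 𝒞 K → ∃ (F L : ModuleCat.{u} R) (f : L →ₗ[R] F) (g : F →ₗ[R] K),
    IsSES f g ∧ FdLE R S 0 F ∧ 𝒞 L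
  ext : ∀ K : ModuleCat.{u} R, 𝒞 K → ∀ (I : Type u) [AddCommGroup I] [Module S I],
    Module.Injective S I → ExtZero R K (CharDual S R I) 1

theorem IsGorensteinFlat.exists_isGFStable {M : ModuleCat.{u} R} (hM : IsGorensteinFlat R M) :
    ∃ 𝒞, IsGFStable R S 𝒞 ∧ 𝒞 M := by
  obtain ⟨F, d, hF, hd, ⟨e⟩, hI⟩ := hM
  have hF' : ∀ n, FdLE R S 0 (F n) := fun n => (isFlatMod_iff _).1 (hF n)
  let Z (n : ℤ) := LinearMap.ker (d n)
  let π (n : ℤ) : F n →ₗ[R] Z (n + 1) :=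
    (d n).codRestrict (Z (n + 1)) fun x => (hd n).apply_apply_eq_zero x
  have hπ : ∀ n, IsSES (Z n).subtype (π n) := fun n => by
    refine ⟨Subtype.val_injective, fun x => ?_, fun x => ?_⟩
    · obtain ⟨y, hy⟩ := (hd n x).1 x.2
      exact ⟨y, Subtype.ext hy⟩
    · exact ⟨fun hx => ⟨⟨x, congrArg Subtype.val hx⟩, rfl⟩, fun ⟨y, hy⟩ =>
        Subtype.ext (hy ▸ y.2)⟩
  have hext : ∀ (I : Type u) [AddCommGroup I] [Module S I], Module.Injective S I →
      ∀ n, ExtZero R (Z n) (CharDual S R I) 1 := by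
    intro I _ _ hinj n
    let _ : Module Rᵐᵒᵖ I := Module.compHom I (OppRing.toOp (R := R) (S := S)).symm.toRingHom
    have hc : ∀ (s : S) (a : I), s • a = OppRing.toOp (R := R) s • a := fun s a => by
      change _ = (OppRing.toOp (R := R) (S := S)).symm (OppRing.toOp (R := R) s) • a
      rw [RingEquiv.symm_apply_apply]
    have hinj' : Module.Injective Rᵐᵒᵖ I :=
      Module.Injective.of_smul_eq (OppRing.toOp (R := R) (S := S)) hc hinj
    obtain ⟨m, rfl⟩ : ∃ m, n = m + 1 + 1 + 1 := ⟨n - 3, by ring⟩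
    refine ExtZero.one_of_extension (hπ (m + 1 + 1)) ((hF' _).extZero I 0) fun k => ?_
    obtain ⟨χ, hχ⟩ := NTensor.exists_character hc (k.comp (π (m + 1)))
    obtain ⟨ψ, hψ⟩ := exists_character_comp_eq (hI I hinj' m) χ fun x => by
      have : χ.comp (NTensor.rmap I (d m)) = 0 := NTensor.hom_ext fun a y => by
        have h0 : π (m + 1) (d m y) = 0 := Subtype.ext ((hd m).apply_apply_eq_zero y)
        rw [AddMonoidHom.comp_apply, NTensor.rmap_tmul, hχ, LinearMap.comp_apply, h0, map_zero]
        rfl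
      exact DFunLike.congr_fun this x
    obtain ⟨l, hl⟩ := NTensor.exists_linearMap hc ψ
    refine ⟨l, fun x => CharDual.ext fun a => ?_⟩
    obtain ⟨y, rfl⟩ := (hπ (m + 1)).surj x
    have h1 : (Z (m + 1 + 1)).subtype (π (m + 1) y) = d (m + 1) y := rfl
    rw [h1, hl, ← NTensor.rmap_tmul, hψ, hχ, LinearMap.comp_apply]
  refine ⟨fun K => ∃ n, Nonempty (K ≃ₗ[R] Z n), ⟨?_, ?_, ?_⟩, 0 + 1,
    ⟨e.trans (LinearEquiv.ofEq _ _ (hd 0).linearMap_ker_eq.symm)⟩⟩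
  · rintro K ⟨n, ⟨e⟩⟩
    exact ⟨F n, ModuleCat.of R (Z (n + 1)), _, _, (hπ n).comp_equiv e, hF' n, n + 1,
      ⟨LinearEquiv.refl _ _⟩⟩
  · rintro K ⟨n, ⟨e⟩⟩
    obtain ⟨m, rfl⟩ : ∃ m, n = m + 1 := ⟨n - 1, by ring⟩
    exact ⟨F m, ModuleCat.of R (Z m), _, _, (hπ m).equiv_comp e.symm, hF' m, m,
      ⟨LinearEquiv.refl _ _⟩⟩
  · rintro K ⟨n, ⟨e⟩⟩ I _ _ hinj
    exact ExtZero.of_equiv e.symm (hext I hinj n)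

theorem IsGFStable.exists_sequence {𝒞 : ModuleCat.{u} R → Prop} (h : IsGFStable R S 𝒞)
    {K : ModuleCat.{u} R} (hK : 𝒞 K) :
    ∃ W : ℤ → ModuleCat.{u} R, W 1 = K ∧ (∀ n, 𝒞 (W n)) ∧
      ∀ n, ∃ (F : ModuleCat.{u} R) (f : W n →ₗ[R] F) (g : F →ₗ[R] W (n + 1)),
        IsSES f g ∧ FdLE R S 0 F := by
  have hs : ∀ K : {K // 𝒞 K}, ∃ C : {K // 𝒞 K}, ∃ (F : ModuleCat.{u} R) (f : K.1 →ₗ[R] F)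
      (g : F →ₗ[R] C.1), IsSES f g ∧ FdLE R S 0 F := fun K => by
    obtain ⟨F, C, f, g, h1, h2, h3⟩ := h.succ K.1 K.2
    exact ⟨⟨C, h3⟩, F, f, g, h1, h2⟩
  have hp : ∀ K : {K // 𝒞 K}, ∃ L : {K // 𝒞 K}, ∃ (F : ModuleCat.{u} R) (f : L.1 →ₗ[R] F)
      (g : F →ₗ[R] K.1), IsSES f g ∧ FdLE R S 0 F := fun K => by
    obtain ⟨F, L, f, g, h1, h2, h3⟩ := h.pred K.1 K.2
    exact ⟨⟨L, h3⟩, F, f, g, h1, h2⟩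
  choose s hs using hs
  choose p hp using hp
  let U : ℕ → {K // 𝒞 K} := fun n => Nat.rec ⟨K, hK⟩ (fun _ => s) n
  let V : ℕ → {K // 𝒞 K} := fun n => Nat.rec (p ⟨K, hK⟩) (fun _ => p) n
  let W : ℤ → {K // 𝒞 K}
    | Int.ofNat 0 => V 0
    | Int.ofNat (n + 1) => U n
    | Int.negSucc n => V (n + 1)
  refine ⟨fun n => (W n).1, rfl, fun n => (W n).2, ?_⟩
  rintro ((_ | n) | (_ | n))
  · exact hp ⟨K, hK⟩
  · exact hs (U n)
  · exact hp (V 0)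
  · exact hp (V (n + 1))

theorem IsGFStable.isGorensteinFlat {𝒞 : ModuleCat.{u} R → Prop} (h : IsGFStable R S 𝒞)
    {K : ModuleCat.{u} R} (hK : 𝒞 K) : IsGorensteinFlat R K := by
  obtain ⟨W, rfl, hW, hF⟩ := h.exists_sequence hK
  choose F f g hfg hF using hF
  let d (n : ℤ) : F n →ₗ[R] F (n + 1) := (f (n + 1)).comp (g n)
  refine ⟨F, d, fun n => (isFlatMod_iff _).2 (hF n), fun n x => ?_, ⟨?_⟩, ?_⟩
  · have : d (n + 1) x = 0 ↔ g (n + 1) x = 0 := by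
      simp only [d, LinearMap.comp_apply]
      rw [map_eq_zero_iff _ (hfg _).inj]
    rw [this, (hfg (n + 1)).exact x]
    constructor
    · rintro ⟨y, rfl⟩
      obtain ⟨z, rfl⟩ := (hfg n).surj y
      exact ⟨z, rfl⟩
    · rintro ⟨z, rfl⟩
      exact ⟨g n z, rfl⟩
  · have : LinearMap.range (d 0) = LinearMap.range (f (0 + 1)) :=
      LinearMap.range_comp_of_range_eq_top _ (LinearMap.range_eq_top.2 (hfg 0).surj)
    exact (LinearEquiv.ofInjective (f (0 + 1)) (hfg (0 + 1)).inj).trans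
      (LinearEquiv.ofEq _ _ this.symm)
  · intro I _ _ hinj n
    let _ : Module S I := Module.compHom I (OppRing.toOp (R := R) (S := S)).toRingHom
    have hc : ∀ (s : S) (a : I), s • a = OppRing.toOp (R := R) s • a := fun _ _ => rfl
    have hinj' : Module.Injective S I :=
      Module.Injective.of_smul_eq (OppRing.toOp (R := R) (S := S)).symm (fun r a => by
        rw [hc, RingEquiv.apply_symm_apply]) hinj
    refine exact_of_characters (fun x => ?_) fun χ hχ => ?_
    · have : (NTensor.rmap I (d (n + 1))).comp (NTensor.rmap I (d n)) = 0 :=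
        NTensor.hom_ext fun a y => by
          have h0 : d (n + 1) (d n y) = d (n + 1) 0 := by
            simp [d, (hfg (n + 1)).exact.apply_apply_eq_zero]
          have h1 : (NTensor.tmul a (0 : F (n + 1 + 1)) : NTensor R I _) = 0 := by
            have := NTensor.tmul_add (R := R) a (0 : F (n + 1 + 1)) 0
            simpa using this
          rw [AddMonoidHom.comp_apply, NTensor.rmap_tmul, NTensor.rmap_tmul, h0, map_zero, h1]
          rfl
      exact DFunLike.congr_fun this x
    · obtain ⟨b, hb⟩ := NTensor.exists_linearMap hc χ
      obtain ⟨b', hb'⟩ := (hfg (n + 1)).exists_desc b fun x => by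
        obtain ⟨y, rfl⟩ := (hfg n).surj x
        refine CharDual.ext fun a => ?_
        have := hχ (NTensor.tmul a y)
        rw [NTensor.rmap_tmul] at this
        rw [hb]
        exact this
      obtain ⟨l, hl⟩ := ExtZero.exists_extension (hfg (n + 1 + 1))
        (h.ext _ (hW (n + 1 + 1 + 1)) I hinj') b'
      obtain ⟨ψ, hψ⟩ := NTensor.exists_character hc l
      refine ⟨ψ, DFunLike.congr_fun (?_ : ψ.comp (NTensor.rmap I (d (n + 1))) = χ)⟩
      refine NTensor.hom_ext fun a m => ?_
      rw [AddMonoidHom.comp_apply, NTensor.rmap_tmul, hψ, ← hb, ← hb', ← hl]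
      rfl

end Flat

section Orthogonality

variable {R S : Type u} [Ring R] [Ring S] [OppRing R S]

theorem IsGorensteinFlat.extZero {G : ModuleCat.{u} R} (hG : IsGorensteinFlat R G) (I : Type u)
    [AddCommGroup I] [Module S I] (hI : Module.Injective S I) (i : ℕ) :
    ExtZero R G (CharDual S R I) (i + 1) := by
  obtain ⟨𝒞, h𝒞, hGC⟩ := hG.exists_isGFStable (S := S)
  clear hG
  induction i generalizing G with
  | zero => exact h𝒞.ext G hGC I hI
  | succ i ih =>
    obtain ⟨F, L, f, g, h, hF, hL⟩ := h𝒞.pred G hGC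
    exact ExtZero.right h (ih hL) (hF.extZero I (i + 1))

theorem gflatDimLE.extZero {n : ℕ} {M : ModuleCat.{u} R} (hM : gflatDimLE R n M) (I : Type u)
    [AddCommGroup I] [Module S I] (hI : Module.Injective S I) {j : ℕ} (hj : n < j) :
    ExtZero R M (CharDual S R I) j := by
  obtain ⟨i, rfl⟩ : ∃ i, j = i + 1 := ⟨j - 1, by omega⟩
  induction n generalizing M i with
  | zero => exact IsGorensteinFlat.extZero hM I hI i
  | succ n ih =>
    obtain ⟨K, G, f, g, h1, h2, h3, hG, hK⟩ := hM
    obtain ⟨i, rfl⟩ : ∃ i', i = i' + 1 := ⟨i - 1, by omega⟩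
    exact ExtZero.right ⟨h1, h2, h3⟩ (ih hK i (by omega)) (hG.extZero I hI (i + 1))

/-- If all modules have Gorenstein flat dimension at most `n`, injective modules on the other
side have flat dimension at most `n`. -/
theorem FdLE.of_forall_gflatDimLE {n : ℕ} (h : ∀ M : ModuleCat.{u} R, gflatDimLE R n M)
    (I : Type u) [AddCommGroup I] [Module S I] (hI : Module.Injective S I) : FdLE S R n I :=
  HasInjectiveDimensionLT.mk fun _ hj Y => (h Y).extZero I hI hj

end Orthogonality

section Cosyzygy

variable (R S : Type u) [Ring R] [Ring S] [OppRing R S]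

/-- Modules admitting a right resolution by flat modules of length `k`, all of whose terms and
cosyzygies are left orthogonal to duals of injectives. -/
def Cosyz : ℕ → ModuleCat.{u} R → Prop
  | 0, A => ∀ (I : Type u) [AddCommGroup I] [Module S I], Module.Injective S I →
      ExtZero R A (CharDual S R I) 1
  | k + 1, A => (∀ (I : Type u) [AddCommGroup I] [Module S I], Module.Injective S I →
      ExtZero R A (CharDual S R I) 1) ∧
      ∃ (F C : ModuleCat.{u} R) (f : A →ₗ[R] F) (g : F →ₗ[R] C),
        IsSES f g ∧ FdLE R S 0 F ∧ Cosyz k C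

variable {R S}

theorem Cosyz.extZero {k : ℕ} {A : ModuleCat.{u} R} (hA : Cosyz R S k A) (I : Type u)
    [AddCommGroup I] [Module S I] (hI : Module.Injective S I) :
    ExtZero R A (CharDual S R I) 1 := by
  cases k with
  | zero => exact hA I hI
  | succ k => exact hA.1 I hI

theorem IsGorensteinFlat.cosyz {G : ModuleCat.{u} R} (hG : IsGorensteinFlat R G) (k : ℕ) :
    Cosyz R S k G := by
  obtain ⟨𝒞, h𝒞, hGC⟩ := hG.exists_isGFStable (S := S)
  clear hG
  induction k generalizing G with
  | zero => exact h𝒞.ext G hGC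
  | succ k ih =>
    obtain ⟨F, C, f, g, h, hF, hC⟩ := h𝒞.succ G hGC
    exact ⟨h𝒞.ext G hGC, F, C, f, g, h, hF, ih hC⟩

theorem FdLE.cosyz {F : ModuleCat.{u} R} (hF : FdLE R S 0 F) (k : ℕ) : Cosyz R S k F := by
  induction k generalizing F with
  | zero => exact fun I _ _ _ => hF.extZero I 0
  | succ k ih =>
    exact ⟨fun I _ _ _ => hF.extZero I 0, F, ModuleCat.of R PUnit, _, _,
      IsSES.of_equiv (LinearEquiv.refl R F), hF, ih FdLE.of_projective⟩

/-- The cokernel of the pure embedding of `F` into its double dual is flat if the double dual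
is. -/
theorem FdLE.coker_eval {F : Type u} [AddCommGroup F] [Module R F]
    (hF : FdLE R S 0 (CharDual S R (CharDual R S F))) {C : Type u} [AddCommGroup C] [Module R C]
    {q : CharDual S R (CharDual R S F) →ₗ[R] C} (h : IsSES (CharDual.eval R S F) q) :
    FdLE R S 0 C := by
  have hd := CharDual.map_isSES (S := S) h
  obtain ⟨r, hr⟩ := hd.exists_lift
    (LinearMap.id - (CharDual.eval S R (CharDual R S F)).comp
      (CharDual.map S (CharDual.eval R S F))) fun φ => by
        rw [LinearMap.sub_apply, map_sub]
        exact sub_self _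
  refine hF.of_dual_retract (CharDual.map S q) r fun x => hd.inj ?_
  rw [hr]
  simp [hd.exact.apply_apply_eq_zero]

theorem Cosyz.of_extension (hS : IsLeftCoherent S) {k : ℕ} {A' A A'' : ModuleCat.{u} R}
    {f : A' →ₗ[R] A} {g : A →ₗ[R] A''} (h : IsSES f g) (hA' : Cosyz R S k A')
    (hA'' : Cosyz R S k A'') : Cosyz R S k A := by
  induction k generalizing A' A A'' with
  | zero => exact fun I _ _ hI => ExtZero.middle h (hA' I hI) (hA'' I hI)
  | succ k ih =>
    obtain ⟨hT', F', C', f', g', h', hF', hC'⟩ := hA'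
    obtain ⟨hT'', F'', C'', f'', g'', h'', hF'', hC''⟩ := hA''
    refine ⟨fun I _ _ hI => ExtZero.middle h (hT' I hI) (hT'' I hI), ?_⟩
    have hD := hF'.double_dual hS
    obtain ⟨l, hl⟩ := ExtZero.exists_extension h (hT'' _ (FdLE.zero_iff.1 hF'))
      ((CharDual.eval R S F').comp f')
    have hinj : Function.Injective (l.prod (f''.comp g)) := by
      rw [injective_iff_map_eq_zero]
      intro x hx
      have h1 : l x = 0 := congrArg Prod.fst hx
      have h2 : f'' (g x) = 0 := congrArg Prod.snd hx
      obtain ⟨y, rfl⟩ := (h.exact x).1 (h''.inj (h2.trans (map_zero f'').symm))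
      rw [hl] at h1
      have h3 : f' y = 0 := CharDual.eval_injective (h1.trans (map_zero _).symm)
      rw [h'.inj (h3.trans (map_zero f').symm), map_zero]
    have hr := IsSES.mkQ (f := (CharDual.eval R S F').comp f')
      (CharDual.eval_injective.comp h'.inj)
    have hq := IsSES.mkQ (f := CharDual.eval R S F') CharDual.eval_injective
    obtain ⟨φ, ψ, hφ⟩ := IsSES.third h' hq hr
    obtain ⟨φ', ψ', hφ'⟩ := IsSES.coker h IsSES.prod hr (IsSES.mkQ hinj) h''
      (fun x => Prod.ext (hl x).symm (by simp [h.exact.apply_apply_eq_zero])) fun x => rfl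
    exact ⟨ModuleCat.of R _, ModuleCat.of R _, _, _, IsSES.mkQ hinj,
      FdLE.middle IsSES.prod hD hF'',
      ih (A' := ModuleCat.of R _) hφ'
        (ih (A'' := ModuleCat.of R _) hφ hC' (FdLE.cosyz (hD.coker_eval hq) k)) hC''⟩

theorem gflatDimLE.exists_embedding (hS : IsLeftCoherent S) {m : ℕ} {M : ModuleCat.{u} R}
    (hM : gflatDimLE R m M) (k : ℕ) :
    ∃ (H A : ModuleCat.{u} R) (f : M →ₗ[R] H) (g : H →ₗ[R] A),
      IsSES f g ∧ FdLE R S m H ∧ Cosyz R S k A := by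
  induction m generalizing M k with
  | zero => exact (IsGorensteinFlat.cosyz hM (k + 1)).2
  | succ m ih =>
    obtain ⟨K, G, ι, π, h1, h2, h3, hG, hK⟩ := hM
    obtain ⟨H, A, f, g, h, hH, hA⟩ := ih hK (k + 1)
    obtain ⟨X, b, q', c, p', hb, hc⟩ := IsSES.pushout ⟨h1, h2, h3⟩ h
    obtain ⟨-, F, C, j, q, hj, hF, hC⟩ := Cosyz.of_extension hS hb (hG.cosyz (k + 1)) hA
    have hr := IsSES.mkQ (f := j.comp c) (hj.inj.comp hc.inj)
    obtain ⟨φ, ψ, hφ⟩ := IsSES.third hc hj hr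
    exact ⟨ModuleCat.of R _, C, φ, ψ, hφ, FdLE.right hr hH hF.of_zero, hC⟩

theorem gflatDimLE.fdLE_of_injective (hS : IsLeftCoherent S) {m : ℕ} {E : ModuleCat.{u} R}
    (hE : gflatDimLE R m E) (hinj : Module.Injective R E) : FdLE R S m E := by
  obtain ⟨H, A, f, g, h, hH, -⟩ := hE.exists_embedding hS 0
  obtain ⟨r, hr⟩ := hinj.out f h.inj LinearMap.id
  exact hH.of_retract f r hr

end Cosyzygy

section Syzygy

/-- `K` is an `n`-th syzygy of `M` in some projective resolution. -/
def IsSyz (R : Type u) [Ring R] : ℕ → ModuleCat.{u} R → ModuleCat.{u} R → Prop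
  | 0, M, K => M = K
  | n + 1, M, K => ∃ (P L : ModuleCat.{u} R) (f : L →ₗ[R] P) (g : P →ₗ[R] M),
      IsSES f g ∧ Module.Projective R P ∧ IsSyz R n L K

variable {R S : Type u} [Ring R] [Ring S] [OppRing R S]

theorem IsSyz.exists_syzygy (n : ℕ) (M : ModuleCat.{u} R) : ∃ K, IsSyz R n M K := by
  induction n generalizing M with
  | zero => exact ⟨M, rfl⟩
  | succ n ih =>
    obtain ⟨L, P, f, g, hP, h⟩ := exists_projective_cover R M
    obtain ⟨K, hK⟩ := ih L
    exact ⟨K, P, L, f, g, h, hP, hK⟩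

theorem IsSyz.snoc {n : ℕ} {M K K₁ P : ModuleCat.{u} R} (hK : IsSyz R n M K)
    {f : K₁ →ₗ[R] P} {g : P →ₗ[R] K} (h : IsSES f g) (hP : Module.Projective R P) :
    IsSyz R (n + 1) M K₁ := by
  induction n generalizing M with
  | zero =>
    obtain rfl := hK
    exact ⟨P, K₁, f, g, h, hP, rfl⟩
  | succ n ih =>
    obtain ⟨P', L, f', g', h', hP', hL⟩ := hK
    exact ⟨P', L, f', g', h', hP', ih hL⟩

/-- The horseshoe lemma for syzygies. -/
theorem IsSyz.horseshoe {n : ℕ} {M E C K : ModuleCat.{u} R} {f : M →ₗ[R] E} {g : E →ₗ[R] C}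
    (h : IsSES f g) (hK : IsSyz R n M K) :
    ∃ (K₂ K₃ : ModuleCat.{u} R) (φ : K →ₗ[R] K₂) (ψ : K₂ →ₗ[R] K₃),
      IsSES φ ψ ∧ IsSyz R n E K₂ ∧ IsSyz R n C K₃ := by
  induction n generalizing M E C with
  | zero =>
    obtain rfl := hK
    exact ⟨E, C, f, g, h, rfl, rfl⟩
  | succ n ih =>
    obtain ⟨P, L, a, c, hac, hP, hL⟩ := hK
    obtain ⟨L', P', a', c', hP', hac'⟩ := exists_projective_cover R C
    obtain ⟨t, ht⟩ := Module.projective_lifting_property g c' h.surj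
    replace ht : ∀ x, g (t x) = c' x := fun x => LinearMap.congr_fun ht x
    have hsurj : Function.Surjective ((f.comp c).coprod t) := fun x => by
      obtain ⟨y, hy⟩ := hac'.surj (g x)
      obtain ⟨m, hm⟩ := (h.exact (x - t y)).1 (by rw [map_sub, ht, hy, sub_self])
      obtain ⟨p, rfl⟩ := hac.surj m
      exact ⟨(p, y), by simp [hm]⟩
    have hker := IsSES.subtype hsurj
    obtain ⟨φ, ψ, hφ⟩ := IsSES.ker h IsSES.prod hac hker hac' (fun x => by simp) fun x => by
      simp [h.exact.apply_apply_eq_zero, ht]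
    obtain ⟨K₂, K₃, φ', ψ', hφ', h₂, h₃⟩ := ih (E := ModuleCat.of R _) hφ hL
    exact ⟨K₂, K₃, φ', ψ', hφ',
      ⟨ModuleCat.of R (P × P'), ModuleCat.of R _, _, _, hker,
        inferInstanceAs (Module.Projective R (P × P')), h₂⟩,
      ⟨P', L', a', c', hac', hP', h₃⟩⟩

theorem IsSyz.fdLE_zero {n : ℕ} {M K : ModuleCat.{u} R} (hK : IsSyz R n M K)
    (hM : FdLE R S n M) : FdLE R S 0 K := by
  induction n generalizing M with
  | zero =>
    obtain rfl := hK
    exact hM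
  | succ n ih =>
    obtain ⟨P, L, f, g, h, hP, hL⟩ := hK
    exact ih hL (FdLE.left h FdLE.of_projective hM)

theorem IsSyz.extZero_one {n : ℕ} {M K : ModuleCat.{u} R} (hK : IsSyz R n M K) {N : Type u}
    [AddCommGroup N] [Module R N] (hM : ExtZero R M N (n + 1)) : ExtZero R K N 1 := by
  induction n generalizing M with
  | zero =>
    obtain rfl := hK
    exact hM
  | succ n ih =>
    obtain ⟨P, L, f, g, h, hP, hL⟩ := hK
    exact ih hL (ExtZero.left h hM (ExtZero.of_projective n))

theorem exists_injective_hull (M : ModuleCat.{u} R) :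
    ∃ (E C : ModuleCat.{u} R) (f : M →ₗ[R] E) (g : E →ₗ[R] C),
      IsSES f g ∧ Module.Injective R E := by
  have hι : Function.Injective (Injective.ι M).hom :=
    (ModuleCat.mono_iff_injective _).1 inferInstance
  exact ⟨Injective.under M, ModuleCat.of R _, _, _, IsSES.mkQ hι,
    (Module.injective_iff_injective_object R _).2
      (inferInstanceAs (Injective (Injective.under M)))⟩

/-- If injective modules on both sides have flat dimension at most `n`, the `n`-th syzygies are
Gorenstein flat. -/
theorem isGFStable_isSyz {n : ℕ}
    (hR : ∀ (E : Type u) [AddCommGroup E] [Module R E], Module.Injective R E → FdLE R S n E)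
    (hS : ∀ (I : Type u) [AddCommGroup I] [Module S I], Module.Injective S I → FdLE S R n I) :
    IsGFStable R S fun K => ∃ M, IsSyz R n M K where
  succ K := by
    rintro ⟨M, hK⟩
    obtain ⟨E, C, f, g, h, hE⟩ := exists_injective_hull M
    obtain ⟨K₂, K₃, φ, ψ, hφ, h₂, h₃⟩ := hK.horseshoe h
    exact ⟨K₂, K₃, φ, ψ, hφ, h₂.fdLE_zero (hR E hE), C, h₃⟩
  pred K := by
    rintro ⟨M, hK⟩
    obtain ⟨K₁, P, f, g, hP, h⟩ := exists_projective_cover R K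
    obtain ⟨-, L, -, -, -, -, hL⟩ := hK.snoc h hP
    exact ⟨P, K₁, f, g, h, FdLE.of_projective, L, hL⟩
  ext K := by
    rintro ⟨M, hK⟩ I _ _ hI
    refine hK.extZero_one fun e => ?_
    have : HasInjectiveDimensionLT (ModuleCat.of R (CharDual S R I)) (n + 1) := hS I hI
    exact e.eq_zero_of_hasInjectiveDimensionLT (n + 1) le_rfl

variable (R S) in
theorem isGFStable_flat : IsGFStable R S fun F => FdLE R S 0 F where
  succ F hF := ⟨F, ModuleCat.of R PUnit, _, _, IsSES.of_equiv (LinearEquiv.refl R F), hF,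
    FdLE.of_projective⟩
  pred F hF := ⟨F, ModuleCat.of R PUnit, _, _, IsSES.of_equiv' (LinearEquiv.refl R F), hF,
    FdLE.of_projective⟩
  ext _ hF I _ _ _ := FdLE.extZero hF I 0

theorem IsGorensteinFlat.of_projective (P : ModuleCat.{u} R) [Module.Projective R P] :
    IsGorensteinFlat R P :=
  (isGFStable_flat R Rᵐᵒᵖ).isGorensteinFlat FdLE.of_projective

theorem IsSyz.gflatDimLE {n : ℕ} {M K : ModuleCat.{u} R} (hK : IsSyz R n M K)
    (h : IsGorensteinFlat R K) : gflatDimLE R n M := by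
  induction n generalizing M with
  | zero =>
    obtain rfl := hK
    exact h
  | succ n ih =>
    obtain ⟨P, L, f, g, hfg, hP, hL⟩ := hK
    exact ⟨L, P, f, g, hfg.inj, hfg.surj, hfg.exact, .of_projective P, ih hL⟩

end Syzygy

section GlobalDimension

theorem gflatDimLE.succ {R : Type u} [Ring R] {n : ℕ} {M : ModuleCat.{u} R}
    (h : gflatDimLE R n M) : gflatDimLE R (n + 1) M := by
  induction n generalizing M with
  | zero =>
    have hM := IsSES.of_equiv' (LinearEquiv.refl R M)
    have : Module.Projective R (ModuleCat.of R PUnit.{u + 1}) :=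
      inferInstanceAs (Module.Projective R PUnit.{u + 1})
    exact ⟨ModuleCat.of R PUnit, M, _, _, hM.inj, hM.surj, hM.exact, h,
      IsGorensteinFlat.of_projective _⟩
  | succ n ih =>
    obtain ⟨K, G, f, g, h1, h2, h3, hG, hK⟩ := h
    exact ⟨K, G, f, g, h1, h2, h3, hG, ih hK⟩

theorem gflatDimLE.mono {R : Type u} [Ring R] {m n : ℕ} (hmn : m ≤ n) {M : ModuleCat.{u} R}
    (h : gflatDimLE R m M) : gflatDimLE R n M := by
  induction n, hmn using Nat.le_induction with
  | base => exact h
  | succ n _ ih => exact ih.succ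

theorem gflatDim_le_iff {R : Type u} [Ring R] {n : ℕ} {M : ModuleCat.{u} R} :
    gflatDim R M ≤ n ↔ gflatDimLE R n M := by
  refine ⟨fun h => ?_, fun h => sInf_le ⟨n, rfl, h⟩⟩
  have hne : {d : ℕ∞ | ∃ n : ℕ, d = n ∧ gflatDimLE R n M}.Nonempty := by
    by_contra hne
    rw [Set.not_nonempty_iff_eq_empty] at hne
    rw [gflatDim, hne, sInf_empty] at h
    exact absurd h (by simp)
  obtain ⟨m, hm, hM⟩ := csInf_mem hne
  rw [gflatDim, hm, Nat.cast_le] at h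
  exact hM.mono h

theorem gorensteinWeakGlobalDim_le_iff {R : Type u} [Ring R] {n : ℕ} :
    gorensteinWeakGlobalDim R ≤ n ↔ ∀ M : ModuleCat.{u} R, gflatDimLE R n M := by
  rw [gorensteinWeakGlobalDim, iSup_le_iff]
  exact forall_congr' fun _ => gflatDim_le_iff

theorem forall_gflatDimLE_iff {R S : Type u} [Ring R] [Ring S] [OppRing R S]
    (hS : IsLeftCoherent S) {n : ℕ} :
    (∀ M : ModuleCat.{u} R, gflatDimLE R n M) ↔
      (∀ (E : Type u) [AddCommGroup E] [Module R E], Module.Injective R E → FdLE R S n E) ∧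
      (∀ (I : Type u) [AddCommGroup I] [Module S I], Module.Injective S I → FdLE S R n I) := by
  refine ⟨fun h => ⟨fun E _ _ hE => (h (ModuleCat.of R E)).fdLE_of_injective hS hE,
    fun I _ _ hI => FdLE.of_forall_gflatDimLE h I hI⟩, fun ⟨hE, hI⟩ M => ?_⟩
  obtain ⟨K, hK⟩ := IsSyz.exists_syzygy n M
  exact hK.gflatDimLE ((isGFStable_isSyz hE hI).isGorensteinFlat ⟨M, hK⟩)

end GlobalDimension

/-- **Theorem 2.8 (consequence).**  If `R` is a left and right coherent ring, then
`l.Gwdim(R) = r.Gwdim(R)`. -/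
theorem gorensteinWeakGlobalDim_eq_of_coherent (R : Type u) [Ring R]
    (hl : IsLeftCoherent R) (hr : IsLeftCoherent Rᵐᵒᵖ) :
    gorensteinWeakGlobalDim R = gorensteinWeakGlobalDim Rᵐᵒᵖ := by
  have key : ∀ n : ℕ, gorensteinWeakGlobalDim R ≤ n ↔ gorensteinWeakGlobalDim Rᵐᵒᵖ ≤ n := by
    intro n
    rw [gorensteinWeakGlobalDim_le_iff, gorensteinWeakGlobalDim_le_iff,
      forall_gflatDimLE_iff (R := R) (S := Rᵐᵒᵖ) hr, forall_gflatDimLE_iff (R := Rᵐᵒᵖ) (S := R) hl]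
    exact and_comm
  refine eq_of_forall_ge_iff fun c => ?_
  induction c using ENat.recTopCoe with
  | top => simp
  | coe n => exact key n
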